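/- arXiv:2603.23336 — 2 statements merged into one kernel-verified Lean document; each statement's English description precedes it below -/
import Mathlib

section
/- Let r : ℕ → ℝ be such that ∑_{n≥1} r(n)²/n and ∑_{n≥1} r(n)⁴/n² converge, and such that the family indexed by quadruples (n₁, n₂, m₁, m₂) of positive integers with n₁·n₂ = m₁·m₂, with value |r(n₁)r(n₂)r(m₁)r(m₂)|/(n₁·n₂), is summable. For φ ∈ ℝ define D₄(φ) = ∑_{n₁·n₂ = m₁·m₂} exp(iφ·((n₁+n₂) − (m₁+m₂)))·r(n₁)r(n₂)r(m₁)r(m₂)/(n₁·n₂). Then (1/(2π))·∫₀^{2π} D₄(φ) dφ = 2·(∑_{n≥1} r(n)²/n)² − ∑_{n≥1} r(n)⁴/n². -/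
open Real

/-- Quadruples `(n₁,n₂,m₁,m₂)` of positive integers with equal products
`n₁n₂ = m₁m₂` (the index set of the fourth-moment coefficient sum `D₄`). -/
def ProdIndex : Set (ℕ × ℕ × ℕ × ℕ) :=
  {q | 0 < q.1 ∧ 0 < q.2.1 ∧ 0 < q.2.2.1 ∧ 0 < q.2.2.2 ∧
       q.1 * q.2.1 = q.2.2.1 * q.2.2.2}

/-- The fourth-moment coefficient sum `D₄(φ)` of the Dirichlet series with
coefficients `e^{inφ} r(n)`: the terms carry the phase
`exp(iφ((n₁+n₂)−(m₁+m₂)))`. -/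
noncomputable def D4 (r : ℕ → ℝ) (φ : ℝ) : ℂ :=
  ∑' q : ProdIndex,
    Complex.exp (Complex.I * (φ : ℂ) *
        (((q.1.1 + q.1.2.1 : ℕ) : ℂ) - ((q.1.2.2.1 + q.1.2.2.2 : ℕ) : ℂ))) *
      ((r q.1.1 * r q.1.2.1 * r q.1.2.2.1 * r q.1.2.2.2 /
        ((q.1.1 : ℝ) * (q.1.2.1 : ℝ))) : ℝ)

lemma vieta_aux {a b c d : ℕ} (hp : a * b = c * d) (hs : a + b = c + d) :
    (c = a ∧ d = b) ∨ (c = b ∧ d = a) := by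
  have h1 : ((a : ℤ) - c) * (a - d) = 0 := by
    have hpz : (a : ℤ) * b = c * d := by exact_mod_cast hp
    have hsz : (a : ℤ) + b = c + d := by exact_mod_cast hs
    have hb : (b : ℤ) = c + d - a := by linarith
    rw [hb] at hpz
    linarith [hpz]
  rcases mul_eq_zero.mp h1 with h | h
  · left; omega
  · right; omega

lemma phase_integral (a b : ℕ) :
    ∫ φ in (0 : ℝ)..(2 * π), Complex.exp (Complex.I * (φ : ℂ) * ((a : ℂ) - (b : ℂ))) =
      if a = b then (2 * π : ℂ) else 0 := by
  split_ifs with h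
  · subst h
    simp
  · have hne : Complex.I * ((a : ℂ) - (b : ℂ)) ≠ 0 := by
      refine mul_ne_zero Complex.I_ne_zero (sub_ne_zero.mpr ?_)
      exact_mod_cast h
    have h1 : ∀ φ : ℝ, Complex.exp (Complex.I * (φ : ℂ) * ((a : ℂ) - (b : ℂ))) =
        Complex.exp (Complex.I * ((a : ℂ) - (b : ℂ)) * (φ : ℂ)) := fun φ => by ring_nf
    simp_rw [h1]
    rw [integral_exp_mul_complex hne]
    have h2 : Complex.exp (Complex.I * ((a : ℂ) - (b : ℂ)) * ((2 * π : ℝ) : ℂ)) = 1 := by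
      rw [Complex.exp_eq_one_iff]
      refine ⟨(a : ℤ) - b, ?_⟩
      push_cast
      ring
    rw [h2]
    simp

/-- The real coefficient of a quadruple. -/
noncomputable def coeffQ (r : ℕ → ℝ) (q : ProdIndex) : ℝ :=
  r q.1.1 * r q.1.2.1 * r q.1.2.2.1 * r q.1.2.2.2 / ((q.1.1 : ℝ) * (q.1.2.1 : ℝ))

def embA (p : ℕ × ℕ) : ProdIndex :=
  ⟨(p.1 + 1, p.2 + 1, p.1 + 1, p.2 + 1), by simp [ProdIndex]⟩

def embB (p : ℕ × ℕ) : ProdIndex :=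
  ⟨(p.1 + 1, p.2 + 1, p.2 + 1, p.1 + 1), by simp [ProdIndex, mul_comm]⟩

def embC (n : ℕ) : ProdIndex :=
  ⟨(n + 1, n + 1, n + 1, n + 1), by simp [ProdIndex]⟩

lemma diag_hasSum (r : ℕ → ℝ)
    (hC : Summable (fun n : ℕ => (r (n + 1)) ^ 2 / (n + 1 : ℝ)))
    (hC4 : Summable (fun n : ℕ => (r (n + 1)) ^ 4 / ((n + 1 : ℝ)) ^ 2)) :
    HasSum (fun q : ProdIndex =>
      if q.1.1 + q.1.2.1 = q.1.2.2.1 + q.1.2.2.2 then coeffQ r q else 0)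
      (2 * (∑' n : ℕ, (r (n + 1)) ^ 2 / (n + 1 : ℝ)) ^ 2 -
        ∑' n : ℕ, (r (n + 1)) ^ 4 / ((n + 1 : ℝ)) ^ 2) := by
  have hprod : HasSum (fun p : ℕ × ℕ => (r (p.1 + 1)) ^ 2 / (p.1 + 1 : ℝ) *
      ((r (p.2 + 1)) ^ 2 / (p.2 + 1 : ℝ))) ((∑' n : ℕ, (r (n + 1)) ^ 2 / (n + 1 : ℝ)) *
      (∑' n : ℕ, (r (n + 1)) ^ 2 / (n + 1 : ℝ))) :=
    hC.hasSum.mul hC.hasSum (summable_mul_of_summable_norm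
      (f := fun n : ℕ => (r (n + 1)) ^ 2 / (n + 1 : ℝ))
      (g := fun n : ℕ => (r (n + 1)) ^ 2 / (n + 1 : ℝ)) hC.norm hC.norm)
  have hA : HasSum (fun q : ProdIndex =>
      if q.1.2.2.1 = q.1.1 ∧ q.1.2.2.2 = q.1.2.1 then coeffQ r q else 0)
      ((∑' n : ℕ, (r (n + 1)) ^ 2 / (n + 1 : ℝ)) *
      (∑' n : ℕ, (r (n + 1)) ^ 2 / (n + 1 : ℝ))) := by
    have hinj : Function.Injective embA := by
      rintro ⟨a, b⟩ ⟨c, d⟩ h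
      have hval := congrArg Subtype.val h
      simp only [embA, Prod.mk.injEq, add_left_inj] at hval
      exact Prod.ext hval.1 hval.2.1
    refine (hinj.hasSum_iff ?_).mp ?_
    · rintro ⟨⟨a, b, c, d⟩, ha, hb, hc, hd, hp⟩ hq
      refine if_neg ?_
      rintro ⟨h1, h2⟩
      dsimp only at h1 h2
      refine hq ⟨(a - 1, b - 1), Subtype.ext ?_⟩
      change 0 < a at ha
      change 0 < b at hb
      simp only [embA, Prod.mk.injEq]
      omega
    · convert hprod using 1
      funext p
      simp [embA, coeffQ]
      field_simp
  have hB : HasSum (fun q : ProdIndex =>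
      if q.1.2.2.1 = q.1.2.1 ∧ q.1.2.2.2 = q.1.1 then coeffQ r q else 0)
      ((∑' n : ℕ, (r (n + 1)) ^ 2 / (n + 1 : ℝ)) *
      (∑' n : ℕ, (r (n + 1)) ^ 2 / (n + 1 : ℝ))) := by
    have hinj : Function.Injective embB := by
      rintro ⟨a, b⟩ ⟨c, d⟩ h
      have hval := congrArg Subtype.val h
      simp only [embB, Prod.mk.injEq, add_left_inj] at hval
      exact Prod.ext hval.1 hval.2.1
    refine (hinj.hasSum_iff ?_).mp ?_
    · rintro ⟨⟨a, b, c, d⟩, ha, hb, hc, hd, hp⟩ hq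
      refine if_neg ?_
      rintro ⟨h1, h2⟩
      dsimp only at h1 h2
      refine hq ⟨(a - 1, b - 1), Subtype.ext ?_⟩
      change 0 < a at ha
      change 0 < b at hb
      simp only [embB, Prod.mk.injEq]
      omega
    · convert hprod using 1
      funext p
      simp [embB, coeffQ]
      field_simp
  have hD : HasSum (fun q : ProdIndex =>
      if q.1.2.1 = q.1.1 ∧ q.1.2.2.1 = q.1.1 ∧ q.1.2.2.2 = q.1.1 then coeffQ r q else 0)
      (∑' n : ℕ, (r (n + 1)) ^ 4 / ((n + 1 : ℝ)) ^ 2) := by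
    have hinj : Function.Injective embC := by
      intro a b h
      have hval := congrArg Subtype.val h
      simp only [embC, Prod.mk.injEq, add_left_inj] at hval
      exact hval.1
    refine (hinj.hasSum_iff ?_).mp ?_
    · rintro ⟨⟨a, b, c, d⟩, ha, hb, hc, hd, hp⟩ hq
      refine if_neg ?_
      rintro ⟨h1, h2, h3⟩
      dsimp only at h1 h2 h3
      refine hq ⟨a - 1, Subtype.ext ?_⟩
      change 0 < a at ha
      change 0 < b at hb
      simp only [embC, Prod.mk.injEq]
      omega
    · convert hC4.hasSum using 1
      funext p
      simp [embC, coeffQ]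
      field_simp
  have hfin := (hA.add hB).sub hD
  have e : ∀ q : ProdIndex,
      ((if q.1.2.2.1 = q.1.1 ∧ q.1.2.2.2 = q.1.2.1 then coeffQ r q else 0) +
        (if q.1.2.2.1 = q.1.2.1 ∧ q.1.2.2.2 = q.1.1 then coeffQ r q else 0)) -
        (if q.1.2.1 = q.1.1 ∧ q.1.2.2.1 = q.1.1 ∧ q.1.2.2.2 = q.1.1 then coeffQ r q else 0) =
      if q.1.1 + q.1.2.1 = q.1.2.2.1 + q.1.2.2.2 then coeffQ r q else 0 := by
    intro q
    obtain ⟨⟨a, b, c, d⟩, ha, hb, hc, hd, hp⟩ := q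
    generalize coeffQ r _ = t
    change a * b = c * d at hp
    dsimp only
    by_cases hs : a + b = c + d
    · rcases vieta_aux hp hs with ⟨h1, h2⟩ | ⟨h1, h2⟩
      · subst h1 h2
        by_cases hcd : d = c
        · subst hcd; simp
        · have : ¬ c = d := fun h => hcd h.symm
          simp [hcd, this]
      · subst h1 h2
        by_cases hcd : d = c
        · subst hcd; simp
        · have : ¬ c = d := fun h => hcd h.symm
          simp [hcd, this, add_comm]
    · rw [if_neg hs, if_neg (by omega), if_neg (by omega), if_neg (by omega)]
      simp
  rw [funext e] at hfin
  rw [two_mul, pow_two]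
  exact hfin

/-- The `φ`-averaged fourth moment is exactly the Wick prediction:
`(1/2π)∫₀^{2π} D₄(φ) dφ = 2C² − C₄`. -/
theorem phi_averaged_D4
    (r : ℕ → ℝ)
    (hC : Summable (fun n : ℕ => (r (n + 1)) ^ 2 / (n + 1 : ℝ)))
    (hC4 : Summable (fun n : ℕ => (r (n + 1)) ^ 4 / ((n + 1 : ℝ)) ^ 2))
    (habs : Summable (fun q : ProdIndex =>
      |r q.1.1 * r q.1.2.1 * r q.1.2.2.1 * r q.1.2.2.2| /
        ((q.1.1 : ℝ) * (q.1.2.1 : ℝ)))) :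
    (1 / (2 * π) : ℂ) * ∫ φ in (0 : ℝ)..(2 * π), D4 r φ =
      ((2 * (∑' n : ℕ, (r (n + 1)) ^ 2 / (n + 1 : ℝ)) ^ 2 -
        ∑' n : ℕ, (r (n + 1)) ^ 4 / ((n + 1 : ℝ)) ^ 2 : ℝ) : ℂ) := by
  have hnorm : ∀ (q : ProdIndex) (φ : ℝ), ‖Complex.exp (Complex.I * (φ : ℂ) *
        (((q.1.1 + q.1.2.1 : ℕ) : ℂ) - ((q.1.2.2.1 + q.1.2.2.2 : ℕ) : ℂ))) *
      ((coeffQ r q : ℝ) : ℂ)‖ = |r q.1.1 * r q.1.2.1 * r q.1.2.2.1 * r q.1.2.2.2| /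
        ((q.1.1 : ℝ) * (q.1.2.1 : ℝ)) := by
    intro q φ
    rw [norm_mul, Complex.norm_exp, Complex.norm_real, Real.norm_eq_abs, coeffQ, abs_div,
      abs_of_nonneg (by positivity : (0 : ℝ) ≤ (q.1.1 : ℝ) * (q.1.2.1 : ℝ))]
    simp
  have key : HasSum (fun q : ProdIndex => ∫ φ in (0 : ℝ)..(2 * π),
      Complex.exp (Complex.I * (φ : ℂ) *
        (((q.1.1 + q.1.2.1 : ℕ) : ℂ) - ((q.1.2.2.1 + q.1.2.2.2 : ℕ) : ℂ))) *
      ((coeffQ r q : ℝ) : ℂ)) (∫ φ in (0 : ℝ)..(2 * π), D4 r φ) := by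
    refine intervalIntegral.hasSum_integral_of_dominated_convergence
      (fun q _ => |r q.1.1 * r q.1.2.1 * r q.1.2.2.1 * r q.1.2.2.2| /
        ((q.1.1 : ℝ) * (q.1.2.1 : ℝ))) ?_ ?_ ?_ ?_ ?_
    · intro q
      refine Continuous.aestronglyMeasurable ?_
      fun_prop
    · intro q
      exact Filter.Eventually.of_forall fun φ _ => (hnorm q φ).le
    · exact Filter.Eventually.of_forall fun φ _ => habs
    · exact intervalIntegrable_const
    · refine Filter.Eventually.of_forall fun φ _ => ?_
      refine Summable.hasSum (Summable.of_norm ?_)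
      simp_rw [hnorm]
      exact habs
  have h2 : HasSum (fun q : ProdIndex => (2 * π : ℂ) * (((if q.1.1 + q.1.2.1 =
      q.1.2.2.1 + q.1.2.2.2 then coeffQ r q else 0 : ℝ)) : ℂ))
      (∫ φ in (0 : ℝ)..(2 * π), D4 r φ) := by
    convert key using 1
    funext q
    rw [intervalIntegral.integral_mul_const, phase_integral]
    split_ifs <;> simp
  have h3 := (Complex.hasSum_ofReal.mpr (diag_hasSum r hC hC4)).mul_left (2 * π : ℂ)
  rw [h2.unique h3]
  have hpi : (π : ℂ) ≠ 0 := by exact_mod_cast Real.pi_ne_zero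
  field_simp
end

section
/- Let L be the entire continuation of the Cantor Dirichlet series (assumed to exist). Then there is a constant K such that for all T ≥ 3, ∫_T^{2T} |L(1/2 + it)|⁴ dt ≤ K·T·(log T)³. -/
open Complex Real

/-- `r(n) = ∏_{j=1}^∞ cos(3n/(4·3^j))`: the real cosine product giving the
Fourier coefficients of the ternary Cantor measure rescaled to `[0.5, 2.0]`. -/
noncomputable def cantorR (n : ℕ) : ℝ :=
  ∏' j : ℕ, Real.cos (3 * n / (4 * 3 ^ (j + 1)))

/-- `â(n) = e^{i(5/4)n} r(n)`: the Fourier coefficients of the rescaled ternary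
Cantor measure. -/
noncomputable def cantorA (n : ℕ) : ℂ :=
  Complex.exp (Complex.I * (5 / 4) * n) * (cantorR n : ℂ)

/-- The Cantor Dirichlet series `∑_{n≥1} â(n) n^{-s}` (as a `tsum`). -/
noncomputable def cantorSeries (s : ℂ) : ℂ :=
  ∑' n : ℕ, cantorA (n + 1) * ((n + 1 : ℕ) : ℂ) ^ (-s)

/-- `d = log 2 / log 3`, the Hausdorff dimension of the ternary Cantor set. -/
noncomputable def cantorDim : ℝ := Real.log 2 / Real.log 3


lemma cantor_tendsto (n : ℕ) : Filter.Tendsto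
    (fun k : ℕ => ∏ j ∈ Finset.range k, Real.cos (3 * n / (4 * 3 ^ (j + 1))))
    Filter.atTop (nhds (cantorR n)) := by
  have hs : Summable (fun j : ℕ => Real.cos (3 * n / (4 * 3 ^ (j + 1))) - 1) := by
    have hg : Summable (fun j : ℕ => ((3 * (n:ℝ)) / 12) ^ 2 / 2 * (1/9 : ℝ) ^ j) :=
      (summable_geometric_of_lt_one (by norm_num) (by norm_num)).mul_left _
    refine Summable.of_norm_bounded hg ?_
    intro j
    have h1 := Real.one_sub_sq_div_two_le_cos (x := 3 * (n:ℝ) / (4 * 3 ^ (j + 1)))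
    have h2 := Real.cos_le_one (3 * (n:ℝ) / (4 * 3 ^ (j + 1)))
    have h3 : (3 * (n:ℝ) / (4 * 3 ^ (j + 1))) ^ 2 / 2 = ((3 * (n:ℝ)) / 12) ^ 2 / 2 * (1/9 : ℝ) ^ j := by
      have : (9:ℝ) ^ j = 3 ^ j * 3 ^ j := by rw [← mul_pow]; norm_num
      rw [pow_succ, one_div, inv_pow, this]
      field_simp
      ring
    rw [Real.norm_eq_abs, abs_of_nonpos (by linarith)]
    linarith
  have hm := multipliable_one_add_of_summable (f := fun j : ℕ => Real.cos (3 * n / (4 * 3 ^ (j + 1))) - 1) hs.norm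
  have := hm.hasProd.tendsto_prod_nat
  simpa [cantorR] using this

lemma cantorA_tendsto (n : ℕ) : Filter.Tendsto
    (fun k : ℕ => Complex.exp (Complex.I * (5 / 4 : ℝ) * n) *
      ((∏ j ∈ Finset.range k, Real.cos (3 * n / (4 * 3 ^ (j + 1))) : ℝ) : ℂ))
    Filter.atTop (nhds (cantorA n)) := by
  have h := (Complex.continuous_ofReal.tendsto _).comp (cantor_tendsto n)
  have := h.const_mul (Complex.exp (Complex.I * (5 / 4 : ℝ) * n))
  simpa [cantorA, Function.comp_def] using this

lemma cantor_avg_fin (S : Finset ℕ) (g : ℕ → ℂ) (B : ℝ)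
    (h : ∀ x : ℝ, |x - 5/4| ≤ 3/8 → ‖∑ n ∈ S, Complex.exp (Complex.I * x * n) * g n‖ ≤ B) (k : ℕ) :
    ∀ c : ℝ, |c - 5/4| ≤ 3/8 / 3 ^ k →
    ‖∑ n ∈ S, Complex.exp (Complex.I * c * n) *
      ((∏ j ∈ Finset.range k, Real.cos (3 * n / (4 * 3 ^ (j + 1))) : ℝ) : ℂ) * g n‖ ≤ B := by
  induction k with
  | zero => intro c hc; simpa using h c (by simpa using hc)
  | succ k ih =>
    intro c hc
    set θ : ℝ := 3 / (4 * 3 ^ (k + 1)) with hθ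
    have hθ0 : 0 ≤ θ := by positivity
    have e : (3:ℝ)/8/3^k = 3/8/3^(k+1) + θ := by
      rw [hθ, pow_succ]; field_simp; norm_num
    have h1 := ih (c + θ) (by
      rw [e]; calc |c + θ - 5/4| = |(c - 5/4) + θ| := by ring_nf
        _ ≤ |c - 5/4| + |θ| := abs_add_le _ _
        _ ≤ _ := by rw [abs_of_nonneg hθ0]; linarith)
    have h2 := ih (c - θ) (by
      rw [e]; calc |c - θ - 5/4| = |(c - 5/4) - θ| := by ring_nf
        _ ≤ |c - 5/4| + |θ| := abs_sub _ _
        _ ≤ _ := by rw [abs_of_nonneg hθ0]; linarith)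
    have key : ∑ n ∈ S, Complex.exp (Complex.I * c * n) *
      ((∏ j ∈ Finset.range (k+1), Real.cos (3 * n / (4 * 3 ^ (j + 1))) : ℝ) : ℂ) * g n
      = (1/2 : ℂ) * (∑ n ∈ S, Complex.exp (Complex.I * (c + θ : ℝ) * n) *
      ((∏ j ∈ Finset.range k, Real.cos (3 * n / (4 * 3 ^ (j + 1))) : ℝ) : ℂ) * g n
      + ∑ n ∈ S, Complex.exp (Complex.I * (c - θ : ℝ) * n) *
      ((∏ j ∈ Finset.range k, Real.cos (3 * n / (4 * 3 ^ (j + 1))) : ℝ) : ℂ) * g n) := by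
      rw [← Finset.sum_add_distrib, Finset.mul_sum]
      refine Finset.sum_congr rfl fun n _ => ?_
      rw [Finset.prod_range_succ, Complex.ofReal_mul, Complex.ofReal_cos]
      have e1 : ((3 * (n:ℝ) / (4 * 3 ^ (k + 1)) : ℝ) : ℂ) = (θ : ℂ) * n := by
        rw [hθ]; push_cast; ring
      have e2 : Complex.exp (Complex.I * (c + θ : ℝ) * n) = Complex.exp (Complex.I * c * n) * Complex.exp ((θ : ℂ) * n * Complex.I) := by
        rw [← Complex.exp_add]; push_cast; ring_nf
      have e3 : Complex.exp (Complex.I * (c - θ : ℝ) * n) = Complex.exp (Complex.I * c * n) * Complex.exp (-((θ : ℂ) * n) * Complex.I) := by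
        rw [← Complex.exp_add]; push_cast; ring_nf
      rw [e1, e2, e3, Complex.cos]
      ring
    rw [key, norm_mul]
    have := norm_add_le (∑ n ∈ S, Complex.exp (Complex.I * (c + θ : ℝ) * n) *
      ((∏ j ∈ Finset.range k, Real.cos (3 * n / (4 * 3 ^ (j + 1))) : ℝ) : ℂ) * g n)
      (∑ n ∈ S, Complex.exp (Complex.I * (c - θ : ℝ) * n) *
      ((∏ j ∈ Finset.range k, Real.cos (3 * n / (4 * 3 ^ (j + 1))) : ℝ) : ℂ) * g n)
    have e4 : ‖(1/2:ℂ)‖ = 1/2 := by simp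
    rw [e4]
    linarith

lemma cantor_avg (S : Finset ℕ) (g : ℕ → ℂ) (B : ℝ)
    (h : ∀ x : ℝ, |x - 5/4| ≤ 3/8 → ‖∑ n ∈ S, Complex.exp (Complex.I * x * n) * g n‖ ≤ B) :
    ‖∑ n ∈ S, cantorA n * g n‖ ≤ B := by
  have ht : Filter.Tendsto (fun k : ℕ => ∑ n ∈ S, Complex.exp (Complex.I * (5/4 : ℝ) * n) *
      ((∏ j ∈ Finset.range k, Real.cos (3 * n / (4 * 3 ^ (j + 1))) : ℝ) : ℂ) * g n)
      Filter.atTop (nhds (∑ n ∈ S, cantorA n * g n)) :=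
    tendsto_finsetSum _ fun n _ => (cantorA_tendsto n).mul_const _
  refine le_of_tendsto ht.norm (Filter.Eventually.of_forall fun k => ?_)
  exact cantor_avg_fin S g B h k (5/4) (by rw [sub_self, abs_zero]; positivity)

lemma one_sub_exp_lower (x : ℝ) (hx : |x - 5/4| ≤ 3/8) :
    1/10 ≤ ‖1 - Complex.exp (Complex.I * x)‖ := by
  rw [abs_le] at hx
  have h1 : (1 - Complex.exp (Complex.I * x)).re = 1 - Real.cos x := by
    rw [mul_comm, Complex.sub_re, Complex.exp_ofReal_mul_I_re]; simp
  have h2 := Complex.abs_re_le_norm (1 - Complex.exp (Complex.I * x))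
  rw [h1] at h2
  have h3 := Real.pi_gt_three
  have h4 := Real.cos_le_one_sub_mul_cos_sq (x := x) (by rw [abs_of_nonneg (by linarith)]; linarith)
  have h5 := Real.pi_lt_d2
  have h6 : (1:ℝ)/5 ≤ 2 / Real.pi ^ 2 := by
    rw [div_le_div_iff₀ (by norm_num) (by positivity)]; nlinarith
  have h7 : (7/8:ℝ)^2 ≤ x ^ 2 := by nlinarith
  have h8 : (1:ℝ)/5 * (7/8)^2 ≤ 2 / Real.pi ^ 2 * x ^ 2 := by gcongr
  have := le_abs_self (1 - Real.cos x)
  norm_num at h8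
  linarith

lemma abel_one (z : ℂ) (f : ℕ → ℂ) (M : ℕ) (k : ℕ) :
    (1 - z) * ∑ n ∈ Finset.Ico M (M + k), z ^ n * f n
      = z ^ M * f M - z ^ (M + k) * f (M + k) +
        z * ∑ n ∈ Finset.Ico M (M + k), z ^ n * (f (n + 1) - f n) := by
  induction k with
  | zero => simp
  | succ k ih =>
    rw [← add_assoc, Finset.sum_Ico_succ_top (by omega), Finset.sum_Ico_succ_top (by omega), mul_add, ih]
    ring

lemma abel_bound (z : ℂ) (hz : ‖z‖ = 1) (hz1 : 1/10 ≤ ‖1 - z‖) (f : ℕ → ℂ) (M k : ℕ) :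
    ‖∑ n ∈ Finset.Ico M (M + k), z ^ n * f n‖ ≤
      10 * (‖f M‖ + ‖f (M + k)‖ + ‖∑ n ∈ Finset.Ico M (M + k), z ^ n * (f (n + 1) - f n)‖) := by
  have h := congrArg norm (abel_one z f M k)
  rw [norm_mul] at h
  have h2 : ‖z ^ M * f M - z ^ (M + k) * f (M + k) +
        z * ∑ n ∈ Finset.Ico M (M + k), z ^ n * (f (n + 1) - f n)‖ ≤ ‖f M‖ + ‖f (M + k)‖ + ‖∑ n ∈ Finset.Ico M (M + k), z ^ n * (f (n + 1) - f n)‖ := by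
    refine (norm_add_le _ _).trans (add_le_add ((norm_sub_le _ _).trans ?_) ?_)
    · simp [hz]
    · simp [hz]
  have h3 : 1/10 * ‖∑ n ∈ Finset.Ico M (M + k), z ^ n * f n‖ ≤ ‖1 - z‖ * ‖∑ n ∈ Finset.Ico M (M + k), z ^ n * f n‖ := by gcongr
  linarith

lemma hasDeriv_cpow (s : ℂ) (x : ℝ) (hx : 0 < x) :
    HasDerivAt (fun y : ℝ => (y : ℂ) ^ (-s)) (-s * (x : ℂ) ^ (-(s + 1))) x := by
  have h1 : HasDerivAt (fun y : ℂ => y ^ (-s)) (-s * (x : ℂ) ^ (-s - 1)) (x : ℂ) := by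
    have := (hasDerivAt_id (x : ℂ)).cpow_const (c := -s) (Or.inl (by simpa using hx))
    simpa using this
  have := h1.comp_ofReal
  convert this using 3
  ring

lemma diff_one (s : ℂ) (hs : 0 ≤ s.re) (x : ℝ) (hx : 0 < x) :
    ‖((x + 1 : ℝ) : ℂ) ^ (-s) - (x : ℂ) ^ (-s)‖ ≤ ‖s‖ * x ^ (-(s.re + 1)) := by
  have := Convex.norm_image_sub_le_of_norm_hasDerivWithin_le (𝕜 := ℝ)
    (f := fun y : ℝ => (y : ℂ) ^ (-s)) (f' := fun y : ℝ => -s * (y : ℂ) ^ (-(s + 1)))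
    (s := Set.Icc x (x+1)) (C := ‖s‖ * x ^ (-(s.re + 1))) (x := x) (y := x + 1)
    (fun y hy => (hasDeriv_cpow s y (by have := hy.1; linarith)).hasDerivWithinAt)
    (fun y hy => by
      have hy0 : 0 < y := by have := hy.1; linarith
      rw [norm_mul, norm_neg, Complex.norm_cpow_eq_rpow_re_of_pos hy0]
      gcongr ‖s‖ * ?_
      simpa using Real.rpow_le_rpow_of_nonpos hx hy.1 (by linarith : -(s.re+1) ≤ 0))
    (convex_Icc _ _) (by simp) (by simp)
  simpa using this

lemma diff_two (s : ℂ) (hs : 0 ≤ s.re) (x : ℝ) (hx : 0 < x) :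
    ‖(((x + 1 + 1 : ℝ) : ℂ) ^ (-s) - ((x + 1 : ℝ) : ℂ) ^ (-s)) -
      (((x + 1 : ℝ) : ℂ) ^ (-s) - (x : ℂ) ^ (-s))‖ ≤ ‖s‖ * (‖s + 1‖ * x ^ (-(s.re + 2))) := by
  have := Convex.norm_image_sub_le_of_norm_hasDerivWithin_le (𝕜 := ℝ)
    (f := fun y : ℝ => ((y + 1 : ℝ) : ℂ) ^ (-s) - (y : ℂ) ^ (-s))
    (f' := fun y : ℝ => -s * ((y + 1 : ℝ) : ℂ) ^ (-(s + 1)) - -s * (y : ℂ) ^ (-(s + 1)))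
    (s := Set.Icc x (x+1)) (C := ‖s‖ * (‖s + 1‖ * x ^ (-(s.re + 2)))) (x := x) (y := x + 1)
    (fun y hy => by
      have hy0 : 0 < y := by have := hy.1; linarith
      have h1 := hasDeriv_cpow s y hy0
      have h2 := (hasDeriv_cpow s (y + 1) (by linarith)).comp_add_const y 1
      exact (h2.sub h1).hasDerivWithinAt)
    (fun y hy => by
      have hy0 : 0 < y := by have := hy.1; linarith
      rw [← mul_sub, norm_mul, norm_neg]
      gcongr ‖s‖ * ?_
      refine (diff_one (s + 1) (by simp; linarith) y hy0).trans ?_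
      gcongr ‖s + 1‖ * ?_
      have e : (s + 1).re + 1 = s.re + 2 := by simp; ring
      rw [e]
      exact Real.rpow_le_rpow_of_nonpos hx hy.1 (by linarith))
    (convex_Icc _ _) (by simp) (by simp)
  simpa using this

lemma sum_inv_sq (M k : ℕ) (hM : 1 ≤ M) :
    ∑ n ∈ Finset.Ico M (M + k), (1 : ℝ) / (n : ℝ) ^ 2 ≤ 2 / M - 2 / (M + k : ℕ) := by
  have hM' : (1:ℝ) ≤ M := by exact_mod_cast hM
  induction k with
  | zero => simp
  | succ k ih =>
    rw [← add_assoc, Finset.sum_Ico_succ_top (by omega)]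
    have : (1:ℝ) / ((M + k : ℕ):ℝ)^2 ≤ 2 / (M + k : ℕ) - 2 / (M + k + 1 : ℕ) := by
      push_cast
      have h : (1:ℝ) ≤ M + k := by have : (0:ℝ) ≤ k := by positivity
                                   linarith
      rw [div_sub_div _ _ (by positivity) (by positivity), div_le_div_iff₀ (by positivity) (by positivity)]
      nlinarith [mul_pos (by linarith : (0:ℝ) < M + k) (by linarith : (0:ℝ) < M + k)]
    linarith

/-- tail bound -/
lemma tail_exp (s : ℂ) (hs : 0 ≤ s.re) (x : ℝ) (hx : |x - 5/4| ≤ 3/8) (M k : ℕ) (hM : 1 ≤ M) :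
    ‖∑ n ∈ Finset.Ico M (M + k), Complex.exp (Complex.I * x * n) * (n : ℂ) ^ (-s)‖ ≤
      20 * (M : ℝ) ^ (-s.re) + 400 * (‖s‖ + 1) ^ 2 * (M : ℝ) ^ (-(s.re + 1)) := by
  set z := Complex.exp (Complex.I * x) with hz
  have hz1 : ‖z‖ = 1 := by rw [hz, mul_comm]; exact Complex.norm_exp_ofReal_mul_I x
  have hz2 := one_sub_exp_lower x hx
  rw [← hz] at hz2
  have hM0 : (0:ℝ) < M := by exact_mod_cast hM
  have e : ∀ n : ℕ, Complex.exp (Complex.I * x * n) = z ^ n := by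
    intro n; rw [hz, ← Complex.exp_nat_mul]; ring_nf
  simp_rw [e]
  have b1 := abel_bound z hz1 hz2 (fun n : ℕ => (n : ℂ) ^ (-s)) M k
  have b2 := abel_bound z hz1 hz2 (fun n : ℕ => ((n + 1 : ℕ) : ℂ) ^ (-s) - (n : ℂ) ^ (-s)) M k
  have f0 : ∀ n : ℕ, M ≤ n → ‖(n : ℂ) ^ (-s)‖ ≤ (M : ℝ) ^ (-s.re) := by
    intro n hn
    have hn0 : (0:ℝ) < n := by exact_mod_cast (by omega : 0 < n)
    have := Complex.norm_cpow_eq_rpow_re_of_pos hn0 (-s)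
    rw [Complex.ofReal_natCast] at this
    rw [this]
    exact Real.rpow_le_rpow_of_nonpos hM0 (by exact_mod_cast hn) (by simpa using hs)
  have f1 : ∀ n : ℕ, M ≤ n → ‖((n + 1 : ℕ) : ℂ) ^ (-s) - (n : ℂ) ^ (-s)‖ ≤ ‖s‖ * (M : ℝ) ^ (-(s.re + 1)) := by
    intro n hn
    have hn0 : (0:ℝ) < n := by exact_mod_cast (by omega : 0 < n)
    have := diff_one s hs n hn0
    push_cast at this ⊢
    refine this.trans ?_
    gcongr ‖s‖ * ?_
    exact Real.rpow_le_rpow_of_nonpos hM0 (by exact_mod_cast hn) (by linarith)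
  have f2 : ∀ n : ℕ, M ≤ n → ‖(((n + 1 + 1 : ℕ) : ℂ) ^ (-s) - ((n + 1 : ℕ) : ℂ) ^ (-s)) -
      (((n + 1 : ℕ) : ℂ) ^ (-s) - (n : ℂ) ^ (-s))‖ ≤ ‖s‖ * ‖s + 1‖ * (M : ℝ) ^ (-s.re) * (1 / (n : ℝ) ^ 2) := by
    intro n hn
    have hn0 : (0:ℝ) < n := by exact_mod_cast (by omega : 0 < n)
    have := diff_two s hs n hn0
    push_cast at this ⊢
    refine this.trans ?_
    have e1 : (n : ℝ) ^ (-(s.re + 2)) = (n : ℝ) ^ (-s.re) * (1 / (n:ℝ) ^ 2) := by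
      rw [neg_add, Real.rpow_add hn0, Real.rpow_neg hn0.le 2]; simp
    rw [e1, ← mul_assoc, ← mul_assoc]
    gcongr ‖s‖ * ‖s + 1‖ * ?_ * _
    exact Real.rpow_le_rpow_of_nonpos hM0 (by exact_mod_cast hn) (by linarith)
  have b3 : ‖∑ n ∈ Finset.Ico M (M + k), z ^ n * ((((n + 1 + 1 : ℕ) : ℂ) ^ (-s) - ((n + 1 : ℕ) : ℂ) ^ (-s)) -
      (((n + 1 : ℕ) : ℂ) ^ (-s) - (n : ℂ) ^ (-s)))‖ ≤ ‖s‖ * ‖s + 1‖ * (2 * (M : ℝ) ^ (-(s.re + 1))) := by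
    refine (norm_sum_le _ _).trans ?_
    calc _ ≤ ∑ n ∈ Finset.Ico M (M + k), ‖s‖ * ‖s + 1‖ * (M : ℝ) ^ (-s.re) * (1 / (n : ℝ) ^ 2) := by
          refine Finset.sum_le_sum fun n hn => ?_
          rw [norm_mul, norm_pow, hz1, one_pow, one_mul]
          exact f2 n (Finset.mem_Ico.1 hn).1
      _ ≤ ‖s‖ * ‖s + 1‖ * (M : ℝ) ^ (-s.re) * (2 / M) := by
          rw [← Finset.mul_sum]
          gcongr
          refine (sum_inv_sq M k hM).trans ?_
          have : (0:ℝ) ≤ 2 / (M + k : ℕ) := by positivity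
          linarith
      _ = _ := by
          rw [neg_add, Real.rpow_add hM0, Real.rpow_neg_one]
          ring
  have g0 := f0 M le_rfl
  have g0' := f0 (M + k) (by omega)
  have g1 := f1 M le_rfl
  have g1' := f1 (M + k) (by omega)
  have hA : 0 ≤ (M : ℝ) ^ (-(s.re + 1)) := by positivity
  have hss : ‖s + 1‖ ≤ ‖s‖ + 1 := by simpa using norm_add_le s 1
  have hprod : 200 * ‖s‖ + 200 * (‖s‖ * ‖s + 1‖) ≤ 400 * (‖s‖ + 1) ^ 2 := by
    nlinarith [norm_nonneg s, mul_le_mul_of_nonneg_left hss (norm_nonneg s)]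
  have hfin := mul_le_mul_of_nonneg_right hprod hA
  nlinarith

lemma tail_cantor (s : ℂ) (hs : 0 ≤ s.re) (M k : ℕ) (hM : 1 ≤ M) :
    ‖∑ n ∈ Finset.Ico M (M + k), cantorA n * (n : ℂ) ^ (-s)‖ ≤
      20 * (M : ℝ) ^ (-s.re) + 400 * (‖s‖ + 1) ^ 2 * (M : ℝ) ^ (-(s.re + 1)) :=
  cantor_avg _ _ _ fun x hx => tail_exp s hs x hx M k hM

lemma cantorR_abs_le_prod (n k : ℕ) :
    |cantorR n| ≤ |∏ j ∈ Finset.range k, Real.cos (3 * n / (4 * 3 ^ (j + 1)))| := by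
  have h := (cantor_tendsto n).abs
  refine le_of_tendsto h (Filter.eventually_atTop.2 ⟨k, fun m hm => ?_⟩)
  induction m, hm using Nat.le_induction with
  | base => exact le_rfl
  | succ m hm ih =>
    rw [Finset.prod_range_succ, abs_mul]
    refine le_trans ?_ ih
    exact mul_le_of_le_one_right (abs_nonneg _) (Real.abs_cos_le_one _)

lemma cantorA_norm (n : ℕ) : ‖cantorA n‖ = |cantorR n| := by
  have h : Complex.exp (Complex.I * (5 / 4) * n) = Complex.exp (((5/4 * n : ℝ) : ℂ) * Complex.I) := by
    push_cast; ring_nf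
  rw [cantorA, norm_mul, h, Complex.norm_exp_ofReal_mul_I, one_mul, Complex.norm_real, Real.norm_eq_abs]

lemma cantorA_norm_le_one (n : ℕ) : ‖cantorA n‖ ≤ 1 := by
  rw [cantorA_norm]; simpa using cantorR_abs_le_prod n 0

noncomputable def cP (M : ℕ) (s : ℂ) : ℂ := ∑ n ∈ Finset.Ico 1 (M + 1), cantorA n * (n : ℂ) ^ (-s)

noncomputable def cBnd (σ R : ℝ) (M : ℕ) : ℝ :=
  20 * ((M + 1 : ℕ) : ℝ) ^ (-σ) + 400 * (R + 1) ^ 2 * ((M + 1 : ℕ) : ℝ) ^ (-(σ + 1))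

lemma cBnd_mono {σ σ' R R' : ℝ} {M M' : ℕ} (h1 : σ ≤ σ') (h0 : 0 < σ) (hR0 : 0 ≤ R') (h2 : R' ≤ R) (h3 : M ≤ M') :
    cBnd σ' R' M' ≤ cBnd σ R M := by
  unfold cBnd
  have a : ((M + 1 : ℕ) : ℝ) ≤ ((M' + 1 : ℕ) : ℝ) := by exact_mod_cast (by omega)
  have b : (1:ℝ) ≤ ((M + 1 : ℕ) : ℝ) := by exact_mod_cast (by omega)
  have key : ∀ t t' : ℝ, 0 < t → t ≤ t' → ((M' + 1 : ℕ) : ℝ) ^ (-t') ≤ ((M + 1 : ℕ) : ℝ) ^ (-t) := by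
    intro t t' ht htt
    calc _ ≤ ((M + 1 : ℕ) : ℝ) ^ (-t') := Real.rpow_le_rpow_of_nonpos (by linarith) a (by linarith)
      _ ≤ _ := Real.rpow_le_rpow_of_exponent_le b (by linarith)
  have k1 := key σ σ' h0 h1
  have k2 := key (σ+1) (σ'+1) (by linarith) (by linarith)
  gcongr

lemma cBnd_tendsto (σ R : ℝ) (h0 : 0 < σ) : Filter.Tendsto (cBnd σ R) Filter.atTop (nhds 0) := by
  have hc : Filter.Tendsto (fun M : ℕ => ((M + 1 : ℕ) : ℝ)) Filter.atTop Filter.atTop :=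
    tendsto_natCast_atTop_atTop.comp (Filter.tendsto_add_atTop_nat 1)
  have h1 := ((tendsto_rpow_neg_atTop h0).comp hc).const_mul 20
  have h2 := ((tendsto_rpow_neg_atTop (by linarith : 0 < σ + 1)).comp hc).const_mul (400 * (R + 1) ^ 2)
  have := h1.add h2
  rw [mul_zero, mul_zero, add_zero] at this
  exact this

lemma cP_diff (s : ℂ) (hs : 0 < s.re) (N m : ℕ) (h : N ≤ m) : ‖cP m s - cP N s‖ ≤ cBnd s.re ‖s‖ N := by
  obtain ⟨k, rfl⟩ := Nat.exists_eq_add_of_le h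
  have := tail_cantor s hs.le (N + 1) k (by omega)
  have e : cP (N + k) s - cP N s = ∑ n ∈ Finset.Ico (N + 1) (N + 1 + k), cantorA n * (n : ℂ) ^ (-s) := by
    unfold cP
    rw [sub_eq_iff_eq_add', show N + k + 1 = N + 1 + k by ring]
    exact (Finset.sum_Ico_consecutive _ (by omega) (by omega)).symm
  rw [e]
  exact this

lemma cP_cauchy (s : ℂ) (hs : 0 < s.re) : CauchySeq (fun M => cP M s) := by
  refine cauchySeq_of_le_tendsto_0 (cBnd s.re ‖s‖) (fun n m N hn hm => ?_) (cBnd_tendsto _ _ hs)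
  rcases le_total n m with h | h
  · rw [dist_comm, dist_eq_norm]
    exact (cP_diff s hs n m h).trans (cBnd_mono le_rfl hs (norm_nonneg _) le_rfl hn)
  · rw [dist_eq_norm]
    exact (cP_diff s hs m n h).trans (cBnd_mono le_rfl hs (norm_nonneg _) le_rfl hm)

lemma L_approx (L : ℂ → ℂ) (hL : Differentiable ℂ L)
    (hLeq : ∀ s : ℂ, 1 < s.re → L s = cantorSeries s) (s : ℂ) (hs : 0 < s.re) (M : ℕ) :
    ‖L s - cP M s‖ ≤ cBnd s.re ‖s‖ M := by
  set U : Set ℂ := {s | 0 < s.re} with hU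
  have hUo : IsOpen U := isOpen_lt continuous_const Complex.continuous_re
  have hex : ∀ s : ℂ, ∃ g : ℂ, s ∈ U → Filter.Tendsto (fun M => cP M s) Filter.atTop (nhds g) := by
    intro s
    by_cases h : s ∈ U
    · obtain ⟨g, hg⟩ := cauchySeq_tendsto_of_complete (cP_cauchy s h)
      exact ⟨g, fun _ => hg⟩
    · exact ⟨0, fun h' => absurd h' h⟩
  choose G hG using hex
  have hGb : ∀ s ∈ U, ∀ M, ‖G s - cP M s‖ ≤ cBnd s.re ‖s‖ M := by
    intro s hs M
    have := ((hG s hs).sub_const (cP M s)).norm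
    exact le_of_tendsto this (Filter.eventually_atTop.2 ⟨M, fun m hm => cP_diff s hs M m hm⟩)
  have hloc : TendstoLocallyUniformlyOn cP G Filter.atTop U := by
    rw [tendstoLocallyUniformlyOn_iff_forall_isCompact hUo]
    intro K hK hKc
    rcases K.eq_empty_or_nonempty with rfl | hne
    · exact tendstoUniformlyOn_empty
    obtain ⟨x, hxK, hx⟩ := hKc.exists_isMinOn hne Complex.continuous_re.continuousOn
    obtain ⟨R, hR⟩ := hKc.isBounded.exists_norm_le
    rw [Metric.tendstoUniformlyOn_iff]
    intro ε hε
    have hxp : 0 < x.re := hK hxK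
    filter_upwards [(cBnd_tendsto x.re R hxp).eventually (gt_mem_nhds hε)] with M hM s hsK
    rw [dist_eq_norm]
    exact ((hGb s (hK hsK) M).trans (cBnd_mono (hx hsK) hxp (norm_nonneg _) (hR s hsK) le_rfl)).trans_lt hM
  have hGd : DifferentiableOn ℂ G U := by
    refine hloc.differentiableOn (Filter.Eventually.of_forall fun M => ?_) hUo
    intro s _
    unfold cP
    refine DifferentiableAt.differentiableWithinAt ?_
    refine DifferentiableAt.fun_sum fun n hn => ?_
    have hn0 : (n : ℂ) ≠ 0 := by
      have := (Finset.mem_Ico.1 hn).1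
      exact_mod_cast (by omega : n ≠ 0)
    exact (DifferentiableAt.const_cpow (by fun_prop) (Or.inl hn0)).const_mul _
  have heq1 : ∀ s : ℂ, 1 < s.re → L s = G s := by
    intro s hs
    rw [hLeq s hs]
    have hsum : Summable (fun n : ℕ => cantorA (n + 1) * ((n + 1 : ℕ) : ℂ) ^ (-s)) := by
      have h1 : Summable (fun n : ℕ => (1:ℝ) / ((n:ℝ) ^ s.re)) := Real.summable_one_div_nat_rpow.2 hs
      have h2 := (summable_nat_add_iff 1).2 h1
      refine Summable.of_norm_bounded h2 fun n => ?_
      have hn0 : (0:ℝ) < ((n + 1 : ℕ) : ℝ) := by positivity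
      have := Complex.norm_cpow_eq_rpow_re_of_pos hn0 (-s)
      rw [Complex.ofReal_natCast] at this
      rw [norm_mul, this, Complex.neg_re, Real.rpow_neg hn0.le, ← one_div]
      exact mul_le_of_le_one_left (by positivity) (cantorA_norm_le_one _)
    have ht := hsum.hasSum.tendsto_sum_nat
    have ht2 : Filter.Tendsto (fun M => cP M s) Filter.atTop (nhds (cantorSeries s)) := by
      refine ht.congr fun M => ?_
      unfold cP
      rw [Finset.sum_Ico_eq_sum_range]
      simp only [Nat.add_sub_cancel, add_comm 1]
    exact tendsto_nhds_unique ht2 (hG s (by simp [hU]; linarith))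
  have hconn : IsPreconnected U := (convex_halfSpace_re_gt 0).isPreconnected
  have h2 : (2:ℂ) ∈ U := by simp [hU]
  have hev : L =ᶠ[nhds (2:ℂ)] G := by
    have : {s : ℂ | 1 < s.re} ∈ nhds (2:ℂ) :=
      (isOpen_lt continuous_const Complex.continuous_re).mem_nhds (by simp)
    filter_upwards [this] with s hs using heq1 s hs
  have := AnalyticOnNhd.eqOn_of_preconnected_of_eventuallyEq
    (hL.differentiableOn.analyticOnNhd hUo) (hGd.analyticOnNhd hUo) hconn h2 hev
  rw [this hs]
  exact hGb s hs M

lemma divisor_bound (ε : ℝ) (hε : 0 < ε) : ∃ C : ℝ, 0 ≤ C ∧ ∀ n : ℕ, n ≠ 0 →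
    (n.divisors.card : ℝ) ≤ C * (n : ℝ) ^ ε := by
  set A : ℝ := max 1 (1 / (ε * Real.log 2)) with hA
  have hA1 : 1 ≤ A := le_max_left _ _
  have hl2 : 0 < ε * Real.log 2 := mul_pos hε (Real.log_pos (by norm_num))
  obtain ⟨P, hP⟩ := exists_nat_ge ((2:ℝ) ^ (1/ε))
  have small : ∀ p e : ℕ, 2 ≤ p → ((e + 1 : ℕ) : ℝ) ≤ A * ((p : ℝ) ^ e) ^ ε := by
    intro p e hp
    have h1 : (2:ℝ) ^ e ≤ (p:ℝ) ^ e := by gcongr; exact_mod_cast hp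
    have h2 : ((2:ℝ) ^ e) ^ ε ≤ ((p:ℝ) ^ e) ^ ε := by gcongr
    have h3 : ((2:ℝ) ^ e) ^ ε = Real.exp (e * (ε * Real.log 2)) := by
      rw [Real.rpow_def_of_pos (by positivity), Real.log_pow]; ring_nf
    have h4 := Real.add_one_le_exp ((e:ℝ) * (ε * Real.log 2))
    have h5 : 1 ≤ A * (ε * Real.log 2) := by
      have : 1 / (ε * Real.log 2) ≤ A := le_max_right _ _
      rwa [div_le_iff₀ hl2] at this
    have h6 : (0:ℝ) ≤ e := by positivity
    calc ((e + 1 : ℕ) : ℝ) = e * 1 + 1 := by push_cast; ring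
      _ ≤ e * (A * (ε * Real.log 2)) + A := by gcongr
      _ = A * (e * (ε * Real.log 2) + 1) := by ring
      _ ≤ A * ((p : ℝ) ^ e) ^ ε := by rw [h3] at h2; gcongr; linarith
  have large : ∀ p e : ℕ, P ≤ p → ((e + 1 : ℕ) : ℝ) ≤ 1 * ((p : ℝ) ^ e) ^ ε := by
    intro p e hp
    have h1 : (2:ℝ) ^ (1/ε) ≤ p := hP.trans (by exact_mod_cast hp)
    have h2 : (2:ℝ) ≤ (p:ℝ) ^ ε := by
      calc (2:ℝ) = ((2:ℝ) ^ (1/ε)) ^ ε := by rw [← Real.rpow_mul (by norm_num)]; simp [hε.ne']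
        _ ≤ _ := by gcongr
    have h3 : ((p : ℝ) ^ e) ^ ε = ((p:ℝ) ^ ε) ^ e := by
      rw [← Real.rpow_natCast, ← Real.rpow_natCast, ← Real.rpow_mul (by positivity), ← Real.rpow_mul (by positivity), mul_comm]
    rw [h3, one_mul]
    calc ((e + 1 : ℕ) : ℝ) ≤ (2:ℝ) ^ e := by exact_mod_cast Nat.lt_two_pow_self
      _ ≤ _ := by gcongr
  refine ⟨A ^ P, by positivity, fun n hn => ?_⟩
  have e1 : (n : ℝ) ^ ε = ∏ p ∈ n.primeFactors, ((p : ℝ) ^ (n.factorization p)) ^ ε := by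
    rw [Real.finsetProd_rpow _ _ (fun i _ => by positivity)]
    congr 1
    conv_lhs => rw [← Nat.prod_factorization_pow_eq_self hn]
    rw [Finsupp.prod, Nat.support_factorization]
    push_cast
    rfl
  rw [Nat.card_divisors hn, e1]
  push_cast
  calc _ ≤ ∏ p ∈ n.primeFactors, ((if p < P then A else 1) * ((p : ℝ) ^ (n.factorization p)) ^ ε) := by
        refine Finset.prod_le_prod (fun i _ => by positivity) fun p hp => ?_
        have hp2 := (Nat.prime_of_mem_primeFactors hp).two_le
        split_ifs with h
        · exact_mod_cast small p _ hp2
        · exact_mod_cast large p _ (not_lt.1 h)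
    _ = (∏ p ∈ n.primeFactors, (if p < P then A else 1)) * ∏ p ∈ n.primeFactors, ((p : ℝ) ^ (n.factorization p)) ^ ε :=
        Finset.prod_mul_distrib
    _ ≤ _ := by
        gcongr
        rw [Finset.prod_ite, Finset.prod_const, Finset.prod_const_one, mul_one]
        refine pow_le_pow_right₀ hA1 ?_
        calc _ ≤ (Finset.range P).card := Finset.card_le_card (by intro p hp; simp at hp ⊢; exact hp.2)
          _ = P := Finset.card_range P

lemma sum_kernel_half (a : ℝ) (ha : 0 < a) (D : ℕ) :
    ∑ d ∈ Finset.range D, 1 / (1 + a ^ 2 * (d : ℝ) ^ 2) ≤ 1 + 2 / a := by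
  rcases D with _ | D
  · simp; positivity
  have h : ∀ D : ℕ, ∑ d ∈ Finset.range D, 1 / (1 + a ^ 2 * ((d + 1 : ℕ) : ℝ) ^ 2) ≤ 2 / a * (1 - 1 / (1 + a * D)) := by
    intro D
    induction D with
    | zero => simp
    | succ D ih =>
      rw [Finset.sum_range_succ]
      have hD : (0:ℝ) ≤ D := by positivity
      have aD : 0 ≤ a * D := by positivity
      have : 1 / (1 + a ^ 2 * ((D + 1 : ℕ) : ℝ) ^ 2) ≤ 2 / a * (1 / (1 + a * D) - 1 / (1 + a * (D + 1 : ℕ))) := by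
        have e : 2 / a * (1 / (1 + a * D) - 1 / (1 + a * (D + 1 : ℕ))) = 2 / ((1 + a * D) * (1 + a * (D + 1))) := by
          push_cast
          have h1 : 1 + a * D ≠ 0 := by positivity
          have h2 : 1 + a * ((D:ℝ) + 1) ≠ 0 := by positivity
          field_simp
          ring
        rw [e, div_le_div_iff₀ (by positivity) (by positivity)]
        push_cast
        nlinarith [sq_nonneg (a * (D + 1) - 1)]
      linarith
  rw [Finset.sum_range_succ']
  have h1 := h D
  have h2 : 2 / a * (1 - 1 / (1 + a * D)) ≤ 2 / a := by
    have : 0 ≤ 2 / a * (1 / (1 + a * D)) := by positivity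
    linarith
  simp at h1 h2 ⊢
  linarith

lemma sum_kernel (a : ℝ) (ha : 0 < a) (N c : ℕ) :
    ∑ h ∈ Finset.range N, 1 / (1 + a ^ 2 * ((h : ℝ) - c) ^ 2) ≤ 2 * (1 + 2 / a) := by
  calc _ ≤ ∑ h ∈ Finset.range (c + N), 1 / (1 + a ^ 2 * ((h : ℝ) - c) ^ 2) := by
        refine Finset.sum_le_sum_of_subset_of_nonneg (by intro x; simp; omega) fun i _ _ => by positivity
    _ = ∑ j ∈ Finset.range c, 1 / (1 + a ^ 2 * ((j + 1 : ℕ) : ℝ) ^ 2) + ∑ d ∈ Finset.range N, 1 / (1 + a ^ 2 * (d : ℝ) ^ 2) := by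
        rw [Finset.sum_range_add]
        congr 1
        · rw [← Finset.sum_range_reflect]
          refine Finset.sum_congr rfl fun j hj => ?_
          have hj := Finset.mem_range.1 hj
          have e : ((c - 1 - j : ℕ) : ℝ) = c - 1 - j := by
            rw [Nat.cast_sub (by omega), Nat.cast_sub (by omega)]; simp
          rw [e]; push_cast; ring_nf
        · refine Finset.sum_congr rfl fun j hj => ?_
          push_cast; ring_nf
    _ ≤ (1 + 2 / a) + (1 + 2 / a) := by
        gcongr
        · have h1 := sum_kernel_half a ha (c + 1)
          rw [Finset.sum_range_succ'] at h1
          simp at h1 ⊢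
          linarith
        · exact sum_kernel_half a ha N
    _ = _ := by ring

noncomputable def cE (ρ y : ℝ) (m : ℕ) (x : ℝ) : ℝ :=
  ∑' n : ℕ, ρ ^ n * Real.cos (n * x) * ∏ j ∈ Finset.range m, (1 + Real.cos (y * 3 ^ j * n))

lemma prod_bd (y : ℝ) (m n : ℕ) : 0 ≤ ∏ j ∈ Finset.range m, (1 + Real.cos (y * 3 ^ j * n)) ∧
    ∏ j ∈ Finset.range m, (1 + Real.cos (y * 3 ^ j * n)) ≤ 2 ^ m := by
  have h0 : ∀ j, 0 ≤ 1 + Real.cos (y * 3 ^ j * n) := fun j => by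
    linarith [Real.neg_one_le_cos (y * 3 ^ j * n)]
  refine ⟨Finset.prod_nonneg fun j _ => h0 j, ?_⟩
  calc _ ≤ ∏ j ∈ Finset.range m, (2:ℝ) := Finset.prod_le_prod (fun j _ => h0 j) fun j _ => by
        linarith [Real.cos_le_one (y * 3 ^ j * n)]
    _ = _ := by simp

lemma cE_summable (ρ y : ℝ) (h0 : 0 ≤ ρ) (h1 : ρ < 1) (m : ℕ) (x : ℝ) : Summable (fun n : ℕ =>
    ρ ^ n * Real.cos (n * x) * ∏ j ∈ Finset.range m, (1 + Real.cos (y * 3 ^ j * n))) := by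
  refine Summable.of_norm_bounded ((summable_geometric_of_lt_one h0 h1).mul_right (2 ^ m)) fun n => ?_
  obtain ⟨a, b⟩ := prod_bd y m n
  rw [norm_mul, norm_mul, Real.norm_eq_abs, Real.norm_eq_abs, Real.norm_eq_abs, abs_of_nonneg a,
    abs_of_nonneg (pow_nonneg h0 n)]
  have := Real.abs_cos_le_one (n * x)
  have h2 : 0 ≤ ρ ^ n := pow_nonneg h0 n
  calc _ ≤ ρ ^ n * 1 * 2 ^ m := by gcongr
    _ = _ := by ring

lemma cE_succ (ρ y : ℝ) (h0 : 0 ≤ ρ) (h1 : ρ < 1) (m : ℕ) (x : ℝ) :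
    cE ρ y (m + 1) x = cE ρ y m x + (1/2) * cE ρ y m (x + y * 3 ^ m) + (1/2) * cE ρ y m (x - y * 3 ^ m) := by
  have s1 := (cE_summable ρ y h0 h1 m x).hasSum
  have s2 := (cE_summable ρ y h0 h1 m (x + y * 3 ^ m)).hasSum.mul_left (1/2)
  have s3 := (cE_summable ρ y h0 h1 m (x - y * 3 ^ m)).hasSum.mul_left (1/2)
  have := (s1.add s2).add s3
  unfold cE
  rw [← this.tsum_eq]
  refine tsum_congr fun n => ?_
  rw [Finset.prod_range_succ]
  have c1 : Real.cos (n * (x + y * 3 ^ m)) = Real.cos (n * x) * Real.cos (y * 3 ^ m * n) - Real.sin (n * x) * Real.sin (y * 3 ^ m * n) := by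
    rw [← Real.cos_add]; ring_nf
  have c2 : Real.cos (n * (x - y * 3 ^ m)) = Real.cos (n * x) * Real.cos (y * 3 ^ m * n) + Real.sin (n * x) * Real.sin (y * 3 ^ m * n) := by
    rw [← Real.cos_sub]; ring_nf
  rw [c1, c2]
  ring

lemma cE_zero (ρ y : ℝ) (h0 : 0 ≤ ρ) (h1 : ρ < 1) (x : ℝ) :
    cE ρ y 0 x = (1 - ρ * Real.cos x) / ((1 - ρ) ^ 2 + 2 * ρ * (1 - Real.cos x)) := by
  have hz : ‖(ρ : ℂ) * Complex.exp (x * Complex.I)‖ < 1 := by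
    rw [norm_mul, Complex.norm_exp_ofReal_mul_I, mul_one, Complex.norm_real, Real.norm_eq_abs, abs_of_nonneg h0]
    exact h1
  have h := Complex.hasSum_re (hasSum_geometric_of_norm_lt_one hz)
  have e : ∀ n : ℕ, (((ρ : ℂ) * Complex.exp (x * Complex.I)) ^ n).re = ρ ^ n * Real.cos (n * x) := by
    intro n
    have : ((ρ : ℂ) * Complex.exp (x * Complex.I)) ^ n = ((ρ ^ n : ℝ) : ℂ) * Complex.exp (((n * x : ℝ) : ℂ) * Complex.I) := by
      rw [mul_pow, ← Complex.exp_nat_mul]; push_cast; ring_nf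
    rw [this, Complex.re_ofReal_mul, Complex.exp_ofReal_mul_I_re]
  simp_rw [e] at h
  unfold cE
  simp only [Finset.range_zero, Finset.prod_empty, mul_one]
  rw [h.tsum_eq, Complex.inv_re]
  have e1 : (1 - (ρ : ℂ) * Complex.exp (x * Complex.I)).re = 1 - ρ * Real.cos x := by
    rw [Complex.sub_re, Complex.re_ofReal_mul, Complex.exp_ofReal_mul_I_re]; simp
  have e2 : (1 - (ρ : ℂ) * Complex.exp (x * Complex.I)).im = - (ρ * Real.sin x) := by
    rw [Complex.sub_im, Complex.im_ofReal_mul, Complex.exp_ofReal_mul_I_im]; simp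
  rw [Complex.normSq_apply, e1, e2]
  congr 1
  nlinarith [Real.sin_sq_add_cos_sq x]

lemma cE_zero_nonneg (ρ y : ℝ) (h0 : 0 ≤ ρ) (h1 : ρ < 1) (x : ℝ) : 0 ≤ cE ρ y 0 x := by
  rw [cE_zero ρ y h0 h1]
  have := Real.cos_le_one x
  apply div_nonneg
  · nlinarith
  · have : 0 ≤ ρ * (1 - Real.cos x) := mul_nonneg h0 (by linarith)
    nlinarith [sq_nonneg (1 - ρ)]

lemma cE_le (ρ y : ℝ) (h0 : 0 ≤ ρ) (h1 : ρ < 1) (m : ℕ) : ∀ x : ℝ,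
    cE ρ y m x ≤ ∑ h ∈ Finset.range (3 ^ m), cE ρ y 0 (x + (h - (3 ^ m - 1) / 2) * y) ∧
    0 ≤ ∑ h ∈ Finset.range (3 ^ m), cE ρ y 0 (x + (h - (3 ^ m - 1) / 2) * y) := by
  have nn : ∀ m x, 0 ≤ ∑ h ∈ Finset.range (3 ^ m), cE ρ y 0 (x + (h - (3 ^ m - 1) / 2) * y) :=
    fun m x => Finset.sum_nonneg fun h _ => cE_zero_nonneg ρ y h0 h1 _
  intro x
  refine ⟨?_, nn m x⟩
  induction m generalizing x with
  | zero => simp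
  | succ m ih =>
    rw [cE_succ ρ y h0 h1]
    have i1 := ih x
    have i2 := ih (x + y * 3 ^ m)
    have i3 := ih (x - y * 3 ^ m)
    have n2 := nn m (x + y * 3 ^ m)
    have n3 := nn m (x - y * 3 ^ m)
    have e : ∑ h ∈ Finset.range (3 ^ (m+1)), cE ρ y 0 (x + (h - (3 ^ (m+1) - 1) / 2) * y)
      = ∑ h ∈ Finset.range (3 ^ m), cE ρ y 0 (x - y * 3 ^ m + (h - (3 ^ m - 1) / 2) * y) +
        ∑ h ∈ Finset.range (3 ^ m), cE ρ y 0 (x + (h - (3 ^ m - 1) / 2) * y) +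
        ∑ h ∈ Finset.range (3 ^ m), cE ρ y 0 (x + y * 3 ^ m + (h - (3 ^ m - 1) / 2) * y) := by
      rw [show 3 ^ (m+1) = 3 ^ m + 3 ^ m + 3 ^ m by ring, Finset.sum_range_add, Finset.sum_range_add]
      congr 1
      · congr 1
        · refine Finset.sum_congr rfl fun h _ => ?_
          congr 1; ring
        · refine Finset.sum_congr rfl fun h _ => ?_
          congr 1; push_cast; ring
      · refine Finset.sum_congr rfl fun h _ => ?_
        congr 1; push_cast; ring
    rw [e]
    linarith

lemma one_sub_cos_lower (x : ℝ) (hx : |x| ≤ 1) : x ^ 2 / 5 ≤ 1 - Real.cos x := by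
  have h3 := Real.pi_gt_three
  have h5 := Real.pi_lt_d2
  have h4 := Real.cos_le_one_sub_mul_cos_sq (x := x) (by linarith)
  have h6 : (1:ℝ)/5 ≤ 2 / Real.pi ^ 2 := by
    rw [div_le_div_iff₀ (by norm_num) (by positivity)]; nlinarith
  have : (1:ℝ)/5 * x ^ 2 ≤ 2 / Real.pi ^ 2 * x ^ 2 := by gcongr
  linarith

lemma cE_zero_upper (δ y x : ℝ) (h0 : 0 < δ) (h1 : δ ≤ 1/2) (hx : |x| ≤ 1) :
    cE (1 - δ) y 0 x ≤ 1/2 + δ / (δ ^ 2 + x ^ 2 / 5) := by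
  rw [cE_zero _ _ (by linarith) (by linarith)]
  have hc := one_sub_cos_lower x hx
  have hx2 : 0 ≤ x ^ 2 := sq_nonneg x
  set u := 1 - Real.cos x with hu
  have hc' : Real.cos x = 1 - u := by rw [hu]; ring
  rw [hc']
  have hden : 0 < δ ^ 2 + x ^ 2 / 5 := by positivity
  have hu0 : 0 ≤ u := le_trans (by positivity) hc
  have hD : δ ^ 2 + x ^ 2 / 5 ≤ (1 - (1 - δ)) ^ 2 + 2 * (1 - δ) * u := by nlinarith
  have hD0 := lt_of_lt_of_le hden hD
  calc _ ≤ 1/2 + δ / ((1 - (1 - δ)) ^ 2 + 2 * (1 - δ) * u) := by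
        rw [← sub_le_iff_le_add, ← sub_nonneg]
        have : 1 / 2 - ((1 - (1 - δ) * (1 - u)) / ((1 - (1 - δ)) ^ 2 + 2 * (1 - δ) * u) - δ / ((1 - (1 - δ)) ^ 2 + 2 * (1 - δ) * u))
          = (δ ^ 2 / 2) / ((1 - (1 - δ)) ^ 2 + 2 * (1 - δ) * u) := by
          have := hD0.ne'
          field_simp
          ring
        rw [this]
        positivity
    _ ≤ _ := by gcongr

lemma cantor_msq (k : ℕ) : ∑ n ∈ Finset.range (3 ^ k), cantorR n ^ 2 ≤ 25 * (3/2 : ℝ) ^ k := by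
  set N : ℝ := 3 ^ k with hN
  have hN1 : 1 ≤ N := one_le_pow₀ (by norm_num)
  set δ : ℝ := 1 / (2 * N) with hδ
  have hδ0 : 0 < δ := by positivity
  have hδ1 : δ ≤ 1/2 := by rw [hδ]; apply one_div_le_one_div_of_le <;> linarith
  set y : ℝ := 3/2 / N with hy
  have hr : ∀ n : ℕ, cantorR n ^ 2 ≤ (1/2) ^ k * ∏ j ∈ Finset.range k, (1 + Real.cos (y * 3 ^ j * n)) := by
    intro n
    have h1 := cantorR_abs_le_prod n k
    rw [← sq_abs]
    calc |cantorR n| ^ 2 ≤ |∏ j ∈ Finset.range k, Real.cos (3 * n / (4 * 3 ^ (j + 1)))| ^ 2 := by gcongr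
      _ = ∏ j ∈ Finset.range k, Real.cos (3 * n / (4 * 3 ^ (j + 1))) ^ 2 := by rw [sq_abs, Finset.prod_pow]
      _ = ∏ j ∈ Finset.range k, (1/2 * (1 + Real.cos (3 * n / (2 * 3 ^ (j + 1))))) := by
          refine Finset.prod_congr rfl fun j _ => ?_
          rw [Real.cos_sq]
          have : 2 * (3 * (n:ℝ) / (4 * 3 ^ (j + 1))) = 3 * n / (2 * 3 ^ (j + 1)) := by field_simp; ring
          rw [this]; ring
      _ = (1/2) ^ k * ∏ j ∈ Finset.range k, (1 + Real.cos (3 * n / (2 * 3 ^ (j + 1)))) := by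
          rw [Finset.prod_mul_distrib]; simp
      _ = _ := by
          congr 1
          rw [← Finset.prod_range_reflect]
          refine Finset.prod_congr rfl fun j hj => ?_
          have hj := Finset.mem_range.1 hj
          congr 2
          have e : N = 3 ^ j * 3 ^ (k - 1 - j + 1) := by
            rw [hN, ← pow_add]; congr 1; omega
          rw [hy, e]
          field_simp
  have hE : ∑ n ∈ Finset.range (3 ^ k), (1/2 : ℝ) * ∏ j ∈ Finset.range k, (1 + Real.cos (y * 3 ^ j * n)) ≤ cE (1 - δ) y k 0 := by
    have hs := cE_summable (1 - δ) y (by linarith) (by linarith) k 0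
    unfold cE
    refine le_trans ?_ (hs.sum_le_tsum (Finset.range (3 ^ k)) ?_)
    · refine Finset.sum_le_sum fun n hn => ?_
      have hp := (prod_bd y k n).1
      have hn : (n : ℝ) ≤ N := by
        rw [hN]; exact_mod_cast (Finset.mem_range.1 hn).le
      have hb := one_add_mul_le_pow (a := -δ) (by linarith) n
      have : n * δ ≤ 1/2 := by
        rw [hδ]
        rw [mul_one_div, div_le_div_iff₀ (by positivity) (by norm_num)]
        linarith
      simp only [mul_zero, Real.cos_zero, mul_one]
      gcongr
      rw [sub_eq_add_neg]
      linarith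
    · intro n _
      have hp := (prod_bd y k n).1
      simp only [mul_zero, Real.cos_zero, mul_one]
      have : 0 ≤ (1 - δ) ^ n := pow_nonneg (by linarith) n
      positivity
  have hE2 := (cE_le (1 - δ) y (by linarith) (by linarith) k 0).1
  obtain ⟨c, hc⟩ : ∃ c : ℕ, 3 ^ k = 2 * c + 1 := by
    have : Odd (3 ^ k) := Odd.pow (by decide)
    exact this
  have hcN : N = 2 * c + 1 := by rw [hN]; exact_mod_cast hc
  have hE3 : ∑ h ∈ Finset.range (3 ^ k), cE (1 - δ) y 0 (0 + (h - (3 ^ k - 1) / 2) * y)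
      ≤ ∑ h ∈ Finset.range (3 ^ k), (1/2 + 2 * N * (1 / (1 + 1 ^ 2 * ((h : ℝ) - c) ^ 2))) := by
    refine Finset.sum_le_sum fun h hh => ?_
    have hh' : (h : ℝ) + 1 ≤ N := by rw [hN]; exact_mod_cast Finset.mem_range.1 hh
    have e : (0 + ((h:ℝ) - (3 ^ k - 1) / 2) * y) = 3 * δ * ((h:ℝ) - c) := by
      rw [← hN, hy, hδ, show (N - 1) / 2 = c by rw [hcN]; ring]
      field_simp
      ring
    rw [e]
    have hh0 : (0:ℝ) ≤ h := by positivity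
    have hc0 : (0:ℝ) ≤ c := by positivity
    have hab : |(h:ℝ) - c| ≤ N / 2 := by rw [abs_le]; constructor <;> linarith
    have hδN : δ * N = 1/2 := by rw [hδ]; field_simp
    refine (cE_zero_upper δ y _ hδ0 hδ1 ?_).trans ?_
    · rw [abs_mul, abs_of_pos (by positivity)]
      nlinarith
    · gcongr
      have hN2 : 2 * N = 1 / δ := by rw [hδ]; field_simp
      rw [hN2, one_div_mul_one_div, div_le_div_iff₀ (by positivity) (by positivity)]
      nlinarith [mul_nonneg (sq_nonneg δ) (sq_nonneg ((h:ℝ) - c))]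
  have hE4 := sum_kernel 1 one_pos (3 ^ k) c
  rw [Finset.sum_add_distrib, ← Finset.mul_sum, Finset.sum_const, Finset.card_range, nsmul_eq_mul] at hE3
  push_cast at hE3
  rw [← Finset.mul_sum] at hE
  have hfin : ∑ n ∈ Finset.range (3 ^ k), ∏ j ∈ Finset.range k, (1 + Real.cos (y * 3 ^ j * n)) ≤ 25 * N := by
    have : 2 * N * ∑ h ∈ Finset.range (3 ^ k), 1 / (1 + 1 ^ 2 * ((h : ℝ) - c) ^ 2) ≤ 2 * N * (2 * (1 + 2 / 1)) := by gcongr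
    rw [← hN] at hE3 hE2
    linarith
  calc _ ≤ ∑ n ∈ Finset.range (3 ^ k), (1/2) ^ k * ∏ j ∈ Finset.range k, (1 + Real.cos (y * 3 ^ j * n)) :=
        Finset.sum_le_sum fun n _ => hr n
    _ = (1/2) ^ k * ∑ n ∈ Finset.range (3 ^ k), ∏ j ∈ Finset.range k, (1 + Real.cos (y * 3 ^ j * n)) := by rw [Finset.mul_sum]
    _ ≤ (1/2) ^ k * (25 * N) := by gcongr
    _ = _ := by rw [hN, div_pow, div_pow]; ring

lemma exp_sub_one_sq (v : ℝ) : (Real.exp v - 1) ^ 2 ≤ v ^ 2 * Real.exp (2 * |v|) := by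
  have key : |Real.exp v - 1| ≤ |v| * Real.exp |v| := by
    rcases le_total 0 v with h | h
    · rw [abs_of_nonneg h, abs_of_nonneg (by linarith [Real.add_one_le_exp v])]
      have h1 := Real.add_one_le_exp (-v)
      have h2 : Real.exp (-v) * Real.exp v = 1 := by rw [← Real.exp_add]; simp
      nlinarith [Real.exp_pos v]
    · rw [abs_of_nonpos h, abs_of_nonpos (by linarith [Real.exp_le_one_iff.2 h])]
      have h1 := Real.add_one_le_exp v
      have h2 : 1 ≤ Real.exp (-v) := Real.one_le_exp (by linarith)
      nlinarith
  have e : Real.exp (2 * |v|) = Real.exp |v| ^ 2 := by rw [← Real.exp_nat_mul]; norm_num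
  rw [e, ← sq_abs v, ← mul_pow, ← sq_abs (Real.exp v - 1)]
  gcongr

lemma gauss_point (T : ℝ) (hT : 1 ≤ T) (m m' : ℝ) (hm : 0 < m) (hm' : 0 < m') :
    Real.exp (-(T ^ 2 * (Real.log m' - Real.log m) ^ 2 / 4)) ≤
      (17 * Real.exp 16) * (1 / (1 + (T / m) ^ 2 * (m' - m) ^ 2)) := by
  set v := Real.log m' - Real.log m with hv
  have hev : Real.exp v = m' / m := by rw [hv, Real.exp_sub, Real.exp_log hm, Real.exp_log hm']
  have e1 : (T / m) ^ 2 * (m' - m) ^ 2 = T ^ 2 * (Real.exp v - 1) ^ 2 := by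
    rw [hev]; field_simp
  rw [e1, mul_one_div, le_div_iff₀ (by positivity)]
  set q := T ^ 2 * v ^ 2 / 16 with hq
  have hq0 : 0 ≤ q := by positivity
  have h1 := exp_sub_one_sq v
  have h2 : 2 * |v| ≤ q + 16 := by
    have : v ^ 2 ≤ T ^ 2 * v ^ 2 := le_mul_of_one_le_left (sq_nonneg v) (one_le_pow₀ hT)
    have h3 := sq_abs v
    nlinarith [sq_nonneg (|v| - 16)]
  have h3 : T ^ 2 * v ^ 2 ≤ 16 * Real.exp q := by
    have := Real.add_one_le_exp q
    rw [hq] at this ⊢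
    linarith
  have h4 : Real.exp (2 * |v|) ≤ Real.exp q * Real.exp 16 := by
    rw [← Real.exp_add]; exact Real.exp_le_exp.2 h2
  have h5 : T ^ 2 * (Real.exp v - 1) ^ 2 ≤ 16 * Real.exp q * (Real.exp q * Real.exp 16) := by
    calc _ ≤ T ^ 2 * (v ^ 2 * Real.exp (2 * |v|)) := by gcongr
      _ = (T ^ 2 * v ^ 2) * Real.exp (2 * |v|) := by ring
      _ ≤ _ := by gcongr
  have h6 : Real.exp (-(T ^ 2 * v ^ 2 / 4)) = (Real.exp (-q)) ^ 4 := by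
    rw [← Real.exp_nat_mul]; congr 1; rw [hq]; push_cast; ring
  have h7 : Real.exp (-q) * Real.exp q = 1 := by rw [← Real.exp_add]; simp
  have h8 : Real.exp (-q) ≤ 1 := Real.exp_le_one_iff.2 (by linarith)
  have h9 := Real.exp_pos (-q)
  have h10 : 1 ≤ Real.exp 16 := Real.one_le_exp (by norm_num)
  rw [h6]
  calc Real.exp (-q) ^ 4 * (1 + T ^ 2 * (Real.exp v - 1) ^ 2)
      ≤ Real.exp (-q) ^ 4 * (1 + 16 * Real.exp q * (Real.exp q * Real.exp 16)) := by gcongr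
    _ = Real.exp (-q) ^ 4 + 16 * (Real.exp (-q) * Real.exp q) ^ 2 * Real.exp (-q) ^ 2 * Real.exp 16 := by ring
    _ ≤ 1 + 16 * 1 ^ 2 * 1 * Real.exp 16 := by
        rw [h7]
        gcongr
        · exact pow_le_one₀ h9.le h8
        · exact pow_le_one₀ h9.le h8
    _ ≤ _ := by linarith

lemma gauss_term (T : ℝ) (hT : 1 ≤ T) (u : ℝ) :
    MeasureTheory.Integrable (fun t : ℝ => Complex.exp (Complex.I * u * t) * Complex.exp (-((1 / T ^ 2 : ℝ) : ℂ) * (t : ℂ) ^ 2)) ∧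
    ‖∫ t : ℝ, Complex.exp (Complex.I * u * t) * Complex.exp (-((1 / T ^ 2 : ℝ) : ℂ) * (t : ℂ) ^ 2)‖
      ≤ 2 * T * Real.exp (-(T ^ 2 * u ^ 2 / 4)) := by
  have hb : 0 < 1 / T ^ 2 := by positivity
  constructor
  · refine (integrable_exp_neg_mul_sq hb).mono' (by fun_prop) (Filter.Eventually.of_forall fun t => ?_)
    rw [norm_mul, Complex.norm_exp, Complex.norm_exp]
    have e1 : (Complex.I * u * t).re = 0 := by simp
    have e2 : (-((1 / T ^ 2 : ℝ) : ℂ) * (t : ℂ) ^ 2).re = -(1 / T ^ 2) * t ^ 2 := by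
      rw [← Complex.ofReal_neg, ← Complex.ofReal_pow, ← Complex.ofReal_mul, Complex.ofReal_re]
    rw [e1, e2]; simp
  · rw [fourierIntegral_gaussian (by rw [Complex.ofReal_re]; exact hb)]
    rw [norm_mul]
    have e1 : (Real.pi : ℂ) / ((1 / T ^ 2 : ℝ) : ℂ) = ((Real.pi * T ^ 2 : ℝ) : ℂ) := by
      push_cast; simp
    have e2 : (-(u : ℂ) ^ 2 / (4 * ((1 / T ^ 2 : ℝ) : ℂ))) = ((-(T ^ 2 * u ^ 2 / 4) : ℝ) : ℂ) := by
      push_cast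
      have : (T : ℂ) ≠ 0 := by exact_mod_cast (by linarith : T ≠ 0)
      field_simp
    rw [e1, e2, Complex.norm_exp, Complex.ofReal_re, Complex.norm_cpow_eq_rpow_re_of_pos (by positivity)]
    have e3 : (1 / 2 : ℂ).re = 1 / 2 := by simp
    gcongr
    rw [e3, ← Real.sqrt_eq_rpow, Real.sqrt_le_left (by positivity)]
    nlinarith [Real.pi_lt_four, sq_nonneg T]

set_option maxHeartbeats 1000000 in
lemma gauss_mv (T : ℝ) (hT : 1 ≤ T) (M : ℕ) (b : ℕ → ℂ) :
    MeasureTheory.Integrable (fun t : ℝ => Real.exp (-(1 / T ^ 2) * t ^ 2) *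
      ‖∑ m ∈ Finset.Ico 1 M, b m * Complex.exp (-(Complex.I * t * Real.log m))‖ ^ 2) ∧
    ∫ t : ℝ, Real.exp (-(1 / T ^ 2) * t ^ 2) *
      ‖∑ m ∈ Finset.Ico 1 M, b m * Complex.exp (-(Complex.I * t * Real.log m))‖ ^ 2
      ≤ (136 * Real.exp 16) * ∑ m ∈ Finset.Ico 1 M, ‖b m‖ ^ 2 * (T + m) := by
  set W : ℝ → ℝ := fun t => Real.exp (-(1 / T ^ 2) * t ^ 2) *
      ‖∑ m ∈ Finset.Ico 1 M, b m * Complex.exp (-(Complex.I * t * Real.log m))‖ ^ 2 with hW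
  have hexp : ∀ t : ℝ, ((W t : ℝ) : ℂ) = ∑ m ∈ Finset.Ico 1 M, ∑ m' ∈ Finset.Ico 1 M,
      (b m * (starRingEnd ℂ) (b m')) * (Complex.exp (Complex.I * (Real.log m' - Real.log m : ℝ) * t) *
        Complex.exp (-((1 / T ^ 2 : ℝ) : ℂ) * (t : ℂ) ^ 2)) := by
    intro t
    rw [hW]
    simp only []
    rw [Complex.ofReal_mul, Complex.ofReal_pow, ← Complex.mul_conj', map_sum, Finset.sum_mul_sum, Finset.mul_sum]
    refine Finset.sum_congr rfl fun m _ => ?_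
    rw [Finset.mul_sum]
    refine Finset.sum_congr rfl fun m' _ => ?_
    have e1 : (starRingEnd ℂ) (b m' * Complex.exp (-(Complex.I * t * Real.log m'))) =
        (starRingEnd ℂ) (b m') * Complex.exp (Complex.I * t * Real.log m') := by
      rw [map_mul, ← Complex.exp_conj]
      congr 2
      rw [map_neg, map_mul, map_mul, Complex.conj_ofReal, Complex.conj_ofReal, Complex.conj_I]
      ring
    have e2 : Complex.exp (Complex.I * (Real.log m' - Real.log m : ℝ) * t) =
        Complex.exp (-(Complex.I * t * Real.log m)) * Complex.exp (Complex.I * t * Real.log m') := by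
      rw [← Complex.exp_add]; congr 1; push_cast; ring
    have e3 : ((Real.exp (-(1 / T ^ 2) * t ^ 2) : ℝ) : ℂ) = Complex.exp (-((1 / T ^ 2 : ℝ) : ℂ) * (t : ℂ) ^ 2) := by
      push_cast; rfl
    rw [e1, e2, e3]
    ring
  have hInt : MeasureTheory.Integrable (fun t : ℝ => ((W t : ℝ) : ℂ)) := by
    simp_rw [hexp]
    refine MeasureTheory.integrable_finsetSum _ fun m _ => MeasureTheory.integrable_finsetSum _ fun m' _ => ?_
    exact (gauss_term T hT _).1.const_mul _
  have hIntR : MeasureTheory.Integrable W := by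
    have := hInt.re
    simpa using this
  refine ⟨hIntR, ?_⟩
  have hval : ((∫ t, W t : ℝ) : ℂ) = ∑ m ∈ Finset.Ico 1 M, ∑ m' ∈ Finset.Ico 1 M,
      (b m * (starRingEnd ℂ) (b m')) * ∫ t : ℝ, (Complex.exp (Complex.I * (Real.log m' - Real.log m : ℝ) * t) *
        Complex.exp (-((1 / T ^ 2 : ℝ) : ℂ) * (t : ℂ) ^ 2)) := by
    rw [← integral_complex_ofReal]
    have : (fun t : ℝ => ((W t : ℝ) : ℂ)) = fun t : ℝ => ∑ m ∈ Finset.Ico 1 M, ∑ m' ∈ Finset.Ico 1 M,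
      (b m * (starRingEnd ℂ) (b m')) * (Complex.exp (Complex.I * (Real.log m' - Real.log m : ℝ) * t) *
        Complex.exp (-((1 / T ^ 2 : ℝ) : ℂ) * (t : ℂ) ^ 2)) := funext hexp
    rw [this]
    rw [MeasureTheory.integral_finsetSum _ fun m _ => MeasureTheory.integrable_finsetSum _ fun m' _ =>
      (gauss_term T hT _).1.const_mul _]
    refine Finset.sum_congr rfl fun m _ => ?_
    rw [MeasureTheory.integral_finsetSum _ fun m' _ => (gauss_term T hT _).1.const_mul _]
    refine Finset.sum_congr rfl fun m' _ => ?_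
    exact MeasureTheory.integral_const_mul _ _
  set g : ℕ → ℕ → ℝ := fun m m' => Real.exp (-(T ^ 2 * (Real.log m' - Real.log m) ^ 2 / 4)) with hg
  have hgsymm : ∀ m m', g m m' = g m' m := by
    intro m m'; rw [hg]; simp only []; congr 1; ring
  have hg0 : ∀ m m', 0 ≤ g m m' := fun m m' => (Real.exp_pos _).le
  have h1 : ∫ t, W t ≤ ∑ m ∈ Finset.Ico 1 M, ∑ m' ∈ Finset.Ico 1 M, (‖b m‖ * ‖b m'‖) * (2 * T * g m m') := by
    calc ∫ t, W t ≤ ‖((∫ t, W t : ℝ) : ℂ)‖ := by rw [Complex.norm_real]; exact le_abs_self _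
      _ ≤ _ := by
        rw [hval]
        refine (norm_sum_le _ _).trans (Finset.sum_le_sum fun m _ => (norm_sum_le _ _).trans (Finset.sum_le_sum fun m' _ => ?_))
        rw [norm_mul, norm_mul, RCLike.norm_conj]
        gcongr
        exact (gauss_term T hT _).2
  have h2 : ∑ m ∈ Finset.Ico 1 M, ∑ m' ∈ Finset.Ico 1 M, (‖b m‖ * ‖b m'‖) * (2 * T * g m m')
      ≤ ∑ m ∈ Finset.Ico 1 M, ∑ m' ∈ Finset.Ico 1 M, ((‖b m‖ ^ 2 * (T * g m m')) + (‖b m'‖ ^ 2 * (T * g m' m))) := by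
    refine Finset.sum_le_sum fun m _ => Finset.sum_le_sum fun m' _ => ?_
    rw [hgsymm m' m]
    have : 0 ≤ T * g m m' := mul_nonneg (by linarith) (hg0 _ _)
    nlinarith [mul_nonneg (sq_nonneg (‖b m‖ - ‖b m'‖)) this]
  have h3 : ∑ m ∈ Finset.Ico 1 M, ∑ m' ∈ Finset.Ico 1 M, ((‖b m‖ ^ 2 * (T * g m m')) + (‖b m'‖ ^ 2 * (T * g m' m)))
      = 2 * ∑ m ∈ Finset.Ico 1 M, ‖b m‖ ^ 2 * (T * ∑ m' ∈ Finset.Ico 1 M, g m m') := by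
    simp_rw [Finset.sum_add_distrib]
    rw [Finset.sum_comm (f := fun m m' => ‖b m'‖ ^ 2 * (T * g m' m)), two_mul]
    simp_rw [Finset.mul_sum]
  have h4 : ∀ m ∈ Finset.Ico 1 M, T * ∑ m' ∈ Finset.Ico 1 M, g m m' ≤ (17 * Real.exp 16) * (4 * (T + m)) := by
    intro m hm
    have hm0 : (0:ℝ) < m := by exact_mod_cast (Finset.mem_Ico.1 hm).1
    have hTm : 0 < T / m := by positivity
    have : ∑ m' ∈ Finset.Ico 1 M, g m m' ≤ (17 * Real.exp 16) * (2 * (1 + 2 / (T / m))) := by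
      calc _ ≤ ∑ m' ∈ Finset.Ico 1 M, (17 * Real.exp 16) * (1 / (1 + (T / m) ^ 2 * ((m' : ℝ) - m) ^ 2)) := by
            refine Finset.sum_le_sum fun m' hm' => ?_
            exact gauss_point T hT m m' hm0 (by exact_mod_cast (Finset.mem_Ico.1 hm').1)
        _ ≤ ∑ m' ∈ Finset.range M, (17 * Real.exp 16) * (1 / (1 + (T / m) ^ 2 * ((m' : ℝ) - m) ^ 2)) := by
            refine Finset.sum_le_sum_of_subset_of_nonneg (by intro x; simp) fun i _ _ => by positivity
        _ ≤ _ := by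
            rw [← Finset.mul_sum]
            gcongr
            exact sum_kernel (T / m) hTm M m
    calc T * ∑ m' ∈ Finset.Ico 1 M, g m m' ≤ T * ((17 * Real.exp 16) * (2 * (1 + 2 / (T / m)))) := by gcongr
      _ = (17 * Real.exp 16) * (2 * T + 4 * m) := by field_simp; ring
      _ ≤ _ := by gcongr; linarith
  calc ∫ t, W t ≤ 2 * ∑ m ∈ Finset.Ico 1 M, ‖b m‖ ^ 2 * (T * ∑ m' ∈ Finset.Ico 1 M, g m m') := h1.trans (h2.trans h3.le)
    _ ≤ 2 * ∑ m ∈ Finset.Ico 1 M, ‖b m‖ ^ 2 * ((17 * Real.exp 16) * (4 * (T + m))) := by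
        exact mul_le_mul_of_nonneg_left (Finset.sum_le_sum fun m hm =>
          mul_le_mul_of_nonneg_left (h4 m hm) (sq_nonneg _)) (by norm_num)
    _ = _ := by
        rw [Finset.mul_sum, Finset.mul_sum]
        refine Finset.sum_congr rfl fun m _ => ?_
        ring

lemma x200 : ((3:ℝ) ^ (1/200 : ℝ)) ^ 200 = 3 := by
  rw [← Real.rpow_natCast, ← Real.rpow_mul (by norm_num)]; norm_num

lemma x_le : (3:ℝ) ^ (1/200 : ℝ) ≤ 9/5 := by
  rw [← pow_le_pow_iff_left₀ (by positivity) (by norm_num) (by norm_num : (200:ℕ) ≠ 0), x200]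
  norm_num

lemma x_le2 : (3/2 : ℝ) * (3:ℝ) ^ (1/200 : ℝ) ≤ (3:ℝ) ^ (3/8 : ℝ) := by
  have e : (3:ℝ) ^ (3/8 : ℝ) = ((3:ℝ) ^ (1/200 : ℝ)) ^ 75 := by
    rw [← Real.rpow_natCast, ← Real.rpow_mul (by norm_num)]; norm_num
  rw [e, ← pow_le_pow_iff_left₀ (by positivity) (by positivity) (by norm_num : (200:ℕ) ≠ 0), mul_pow, x200,
    ← pow_mul, mul_comm 75 200, pow_mul, x200]
  norm_num

lemma pow_rpow_comm (k : ℕ) (t : ℝ) : (((3 ^ k : ℕ) : ℝ)) ^ t = ((3:ℝ) ^ t) ^ k := by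
  push_cast
  rw [← Real.rpow_natCast, ← Real.rpow_natCast, ← Real.rpow_mul (by norm_num), ← Real.rpow_mul (by norm_num), mul_comm]

lemma S_one (k : ℕ) : ∑ n ∈ Finset.Ico 1 (3 ^ k), cantorR n ^ 2 * (n : ℝ) ^ (1/200 - 1 : ℝ) ≤ 375 * (1 - (9/10) ^ k) := by
  induction k with
  | zero => simp
  | succ k ih =>
    have hlt : 3 ^ k ≤ 3 ^ (k + 1) := Nat.pow_le_pow_right (by norm_num) (by omega)
    rw [← Finset.sum_Ico_consecutive _ (Nat.one_le_pow _ _ (by norm_num)) hlt]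
    have h : ∑ n ∈ Finset.Ico (3 ^ k) (3 ^ (k+1)), cantorR n ^ 2 * (n : ℝ) ^ (1/200 - 1 : ℝ) ≤ (75/2) * (9/10) ^ k := by
      calc _ ≤ ∑ n ∈ Finset.Ico (3 ^ k) (3 ^ (k+1)), cantorR n ^ 2 * ((3 ^ k : ℕ) : ℝ) ^ (1/200 - 1 : ℝ) := by
            refine Finset.sum_le_sum fun n hn => ?_
            gcongr cantorR n ^ 2 * ?_
            exact Real.rpow_le_rpow_of_nonpos (by positivity) (by exact_mod_cast (Finset.mem_Ico.1 hn).1) (by norm_num)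
        _ = (∑ n ∈ Finset.Ico (3 ^ k) (3 ^ (k+1)), cantorR n ^ 2) * ((3 ^ k : ℕ) : ℝ) ^ (1/200 - 1 : ℝ) := by
            rw [Finset.sum_mul]
        _ ≤ (25 * (3/2 : ℝ) ^ (k+1)) * ((3 ^ k : ℕ) : ℝ) ^ (1/200 - 1 : ℝ) := by
            gcongr
            refine le_trans ?_ (cantor_msq (k+1))
            exact Finset.sum_le_sum_of_subset_of_nonneg (by intro x; simp) fun i _ _ => by positivity
        _ = (75/2) * ((3/2) * (3:ℝ) ^ (1/200 - 1 : ℝ)) ^ k := by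
            rw [pow_rpow_comm, mul_pow]; ring
        _ ≤ _ := by
            gcongr
            rw [Real.rpow_sub (by norm_num), Real.rpow_one]
            linarith [x_le]
    rw [pow_succ (9/10 : ℝ)]
    linarith

lemma S_two (k : ℕ) : ∑ n ∈ Finset.Ico 1 (3 ^ k), cantorR n ^ 2 * (n : ℝ) ^ (1/200 : ℝ) ≤
    25 * ((3 ^ k : ℕ) : ℝ) ^ (3/8 : ℝ) := by
  calc _ ≤ ∑ n ∈ Finset.Ico 1 (3 ^ k), cantorR n ^ 2 * ((3 ^ k : ℕ) : ℝ) ^ (1/200 : ℝ) := by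
        refine Finset.sum_le_sum fun n hn => ?_
        gcongr
        exact (Finset.mem_Ico.1 hn).2.le
    _ = (∑ n ∈ Finset.Ico 1 (3 ^ k), cantorR n ^ 2) * ((3 ^ k : ℕ) : ℝ) ^ (1/200 : ℝ) := by rw [Finset.sum_mul]
    _ ≤ (25 * (3/2 : ℝ) ^ k) * ((3 ^ k : ℕ) : ℝ) ^ (1/200 : ℝ) := by
        gcongr
        refine le_trans ?_ (cantor_msq k)
        exact Finset.sum_le_sum_of_subset_of_nonneg (by intro x; simp) fun i _ _ => by positivity
    _ = 25 * ((3/2) * (3:ℝ) ^ (1/200 : ℝ)) ^ k := by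
        rw [pow_rpow_comm, mul_pow]; ring
    _ ≤ _ := by
        rw [pow_rpow_comm]
        gcongr
        exact x_le2

noncomputable def cC (n : ℕ) : ℂ := cantorA n * (((n : ℝ) ^ (-(1/2) : ℝ) : ℝ) : ℂ)

noncomputable def cB (N m : ℕ) : ℂ :=
  ∑ p ∈ (Finset.Ico 1 N ×ˢ Finset.Ico 1 N) with p.1 * p.2 = m, cC p.1 * cC p.2

lemma cP_eq (N : ℕ) (t : ℝ) : cP N (1/2 + t * Complex.I) =
    ∑ n ∈ Finset.Ico 1 (N + 1), cC n * Complex.exp (-(Complex.I * t * Real.log n)) := by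
  unfold cP cC
  refine Finset.sum_congr rfl fun n hn => ?_
  have hn0 : (0:ℝ) < n := by exact_mod_cast (Finset.mem_Ico.1 hn).1
  have hnc : (n : ℂ) ≠ 0 := by exact_mod_cast hn0.ne'
  rw [mul_assoc]
  congr 1
  rw [neg_add, Complex.cpow_add _ _ hnc]
  congr 1
  · rw [Complex.ofReal_cpow hn0.le]; push_cast; rfl
  · rw [Complex.cpow_def_of_ne_zero hnc, Complex.ofReal_log hn0.le]; push_cast; ring_nf

lemma cP_sq (N : ℕ) (t : ℝ) :
    (∑ n ∈ Finset.Ico 1 N, cC n * Complex.exp (-(Complex.I * t * Real.log n))) ^ 2 =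
    ∑ m ∈ Finset.Ico 1 (N * N), cB N m * Complex.exp (-(Complex.I * t * Real.log m)) := by
  rw [sq, Finset.sum_mul_sum, ← Finset.sum_product']
  rw [← Finset.sum_fiberwise_of_maps_to (s := Finset.Ico 1 N ×ˢ Finset.Ico 1 N) (t := Finset.Ico 1 (N * N))
    (g := fun p : ℕ × ℕ => p.1 * p.2)]
  · refine Finset.sum_congr rfl fun m hm => ?_
    unfold cB
    rw [Finset.sum_mul]
    refine Finset.sum_congr rfl fun p hp => ?_
    rw [Finset.mem_filter, Finset.mem_product, Finset.mem_Ico, Finset.mem_Ico] at hp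
    obtain ⟨⟨h1, h2⟩, h3⟩ := hp
    have a1 : (p.1 : ℝ) ≠ 0 := by exact_mod_cast (by omega : p.1 ≠ 0)
    have a2 : (p.2 : ℝ) ≠ 0 := by exact_mod_cast (by omega : p.2 ≠ 0)
    rw [← h3, Nat.cast_mul, Real.log_mul a1 a2]
    have : Complex.exp (-(Complex.I * t * ((Real.log p.1 + Real.log p.2 : ℝ) : ℂ))) =
      Complex.exp (-(Complex.I * t * Real.log p.1)) * Complex.exp (-(Complex.I * t * Real.log p.2)) := by
      rw [← Complex.exp_add]; congr 1; push_cast; ring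
    rw [this]; ring
  · intro p hp
    rw [Finset.mem_product, Finset.mem_Ico, Finset.mem_Ico] at hp
    rw [Finset.mem_Ico]
    constructor
    · exact Nat.mul_pos hp.1.1 hp.2.1
    · exact Nat.mul_lt_mul'' hp.1.2 hp.2.2

lemma cC_normsq (n : ℕ) (hn : 1 ≤ n) : ‖cC n‖ ^ 2 = cantorR n ^ 2 * (n : ℝ) ^ (-1 : ℝ) := by
  have hn0 : (0:ℝ) < n := by exact_mod_cast hn
  unfold cC
  rw [norm_mul, cantorA_norm, Complex.norm_real, Real.norm_eq_abs, mul_pow, sq_abs, sq_abs,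
    ← Real.rpow_natCast ((n:ℝ) ^ _), ← Real.rpow_mul hn0.le]
  norm_num

lemma cB_sum (Cd : ℝ) (hCd0 : 0 ≤ Cd) (hCd : ∀ n : ℕ, n ≠ 0 → (n.divisors.card : ℝ) ≤ Cd * (n : ℝ) ^ (1/200 : ℝ))
    (N : ℕ) (T : ℝ) (hT : 1 ≤ T) :
    ∑ m ∈ Finset.Ico 1 (N * N), ‖cB N m‖ ^ 2 * (T + m) ≤
      Cd * (T * (∑ n ∈ Finset.Ico 1 N, cantorR n ^ 2 * (n : ℝ) ^ (1/200 - 1 : ℝ)) ^ 2 +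
        (∑ n ∈ Finset.Ico 1 N, cantorR n ^ 2 * (n : ℝ) ^ (1/200 : ℝ)) ^ 2) := by
  set F : ℕ × ℕ → ℝ := fun p => Cd * (T * ((cantorR p.1 ^ 2 * (p.1 : ℝ) ^ (1/200 - 1 : ℝ)) * (cantorR p.2 ^ 2 * (p.2 : ℝ) ^ (1/200 - 1 : ℝ)))
    + (cantorR p.1 ^ 2 * (p.1 : ℝ) ^ (1/200 : ℝ)) * (cantorR p.2 ^ 2 * (p.2 : ℝ) ^ (1/200 : ℝ))) with hF
  have h1 : ∀ m ∈ Finset.Ico 1 (N * N), ‖cB N m‖ ^ 2 * (T + m) ≤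
      ∑ p ∈ (Finset.Ico 1 N ×ˢ Finset.Ico 1 N) with p.1 * p.2 = m, F p := by
    intro m hm
    have hm1 := (Finset.mem_Ico.1 hm).1
    have hcard : ((((Finset.Ico 1 N ×ˢ Finset.Ico 1 N).filter (fun p => p.1 * p.2 = m)).card : ℕ) : ℝ) ≤ Cd * (m : ℝ) ^ (1/200 : ℝ) := by
      refine le_trans ?_ (hCd m (by omega))
      have : ((Finset.Ico 1 N ×ˢ Finset.Ico 1 N).filter (fun p => p.1 * p.2 = m)).card ≤ m.divisors.card := by
        refine Finset.card_le_card_of_injOn (fun p => p.1) ?_ ?_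
        · intro p hp
          simp only [Finset.coe_filter, Set.mem_setOf_eq] at hp
          simp only [Finset.mem_coe, Nat.mem_divisors]
          exact ⟨⟨p.2, hp.2.symm⟩, by omega⟩
        · intro p hp q hq hpq
          simp only [Finset.coe_filter, Set.mem_setOf_eq, Finset.mem_product, Finset.mem_Ico] at hp hq
          simp only at hpq
          refine Prod.ext hpq ?_
          have : p.1 * p.2 = p.1 * q.2 := by rw [hp.2, hpq, hq.2]
          exact Nat.eq_of_mul_eq_mul_left hp.1.1.1 this
      exact_mod_cast this
    have hb : ‖cB N m‖ ^ 2 ≤ Cd * (m : ℝ) ^ (1/200 : ℝ) *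
        ∑ p ∈ (Finset.Ico 1 N ×ˢ Finset.Ico 1 N) with p.1 * p.2 = m, (‖cC p.1‖ * ‖cC p.2‖) ^ 2 := by
      calc ‖cB N m‖ ^ 2 ≤ (∑ p ∈ (Finset.Ico 1 N ×ˢ Finset.Ico 1 N) with p.1 * p.2 = m, ‖cC p.1‖ * ‖cC p.2‖) ^ 2 := by
            gcongr
            unfold cB
            refine (norm_sum_le _ _).trans (Finset.sum_le_sum fun p _ => ?_)
            rw [norm_mul]
        _ ≤ _ := sq_sum_le_card_mul_sum_sq
        _ ≤ _ := by gcongr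
    calc ‖cB N m‖ ^ 2 * (T + m) ≤ (Cd * (m : ℝ) ^ (1/200 : ℝ) *
        ∑ p ∈ (Finset.Ico 1 N ×ˢ Finset.Ico 1 N) with p.1 * p.2 = m, (‖cC p.1‖ * ‖cC p.2‖) ^ 2) * (T + m) := by gcongr
      _ = ∑ p ∈ (Finset.Ico 1 N ×ˢ Finset.Ico 1 N) with p.1 * p.2 = m, F p := by
        rw [Finset.mul_sum, Finset.sum_mul]
        refine Finset.sum_congr rfl fun p hp => ?_
        rw [Finset.mem_filter, Finset.mem_product, Finset.mem_Ico, Finset.mem_Ico] at hp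
        obtain ⟨⟨g1, g2⟩, g3⟩ := hp
        have a1 : (0:ℝ) < p.1 := by exact_mod_cast g1.1
        have a2 : (0:ℝ) < p.2 := by exact_mod_cast g2.1
        rw [mul_pow, cC_normsq _ g1.1, cC_normsq _ g2.1, ← g3, Nat.cast_mul, Real.mul_rpow a1.le a2.le, hF]
        simp only []
        rw [Real.rpow_sub a1, Real.rpow_sub a2, Real.rpow_one, Real.rpow_one, Real.rpow_neg_one, Real.rpow_neg_one]
        field_simp
  calc _ ≤ ∑ m ∈ Finset.Ico 1 (N * N), ∑ p ∈ (Finset.Ico 1 N ×ˢ Finset.Ico 1 N) with p.1 * p.2 = m, F p :=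
        Finset.sum_le_sum h1
    _ = ∑ p ∈ Finset.Ico 1 N ×ˢ Finset.Ico 1 N, F p := by
        refine Finset.sum_fiberwise_of_maps_to (g := fun p : ℕ × ℕ => p.1 * p.2) ?_ F
        intro p hp
        rw [Finset.mem_product, Finset.mem_Ico, Finset.mem_Ico] at hp
        rw [Finset.mem_Ico]
        constructor
        · exact Nat.mul_pos hp.1.1 hp.2.1
        · exact Nat.mul_lt_mul'' hp.1.2 hp.2.2
    _ = _ := by
        rw [hF, ← Finset.mul_sum, Finset.sum_add_distrib, ← Finset.mul_sum, sq, sq, Finset.sum_mul_sum, Finset.sum_mul_sum,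
          ← Finset.sum_product', ← Finset.sum_product']

lemma fourth_gauss : ∃ C : ℝ, 0 ≤ C ∧ ∀ T : ℝ, 1 ≤ T → ∀ k M : ℕ, M + 1 = 3 ^ k →
    MeasureTheory.Integrable (fun t : ℝ => Real.exp (-(1 / T ^ 2) * t ^ 2) * ‖cP M (1/2 + t * Complex.I)‖ ^ 4) ∧
    ∫ t : ℝ, Real.exp (-(1 / T ^ 2) * t ^ 2) * ‖cP M (1/2 + t * Complex.I)‖ ^ 4 ≤
      C * (T + ((3 ^ k : ℕ) : ℝ) ^ (3/4 : ℝ)) := by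
  obtain ⟨Cd, hCd0, hCd⟩ := divisor_bound (1/200) (by norm_num)
  refine ⟨(136 * Real.exp 16) * (Cd * 375 ^ 2), by positivity, fun T hT k M hM => ?_⟩
  have e : ∀ t : ℝ, ‖cP M (1/2 + t * Complex.I)‖ ^ 4 =
      ‖∑ m ∈ Finset.Ico 1 (3 ^ k * 3 ^ k), cB (3 ^ k) m * Complex.exp (-(Complex.I * t * Real.log m))‖ ^ 2 := by
    intro t
    rw [← cP_sq, cP_eq, hM, norm_pow]; ring
  simp_rw [e]
  obtain ⟨h1, h2⟩ := gauss_mv T hT (3 ^ k * 3 ^ k) (cB (3 ^ k))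
  refine ⟨h1, h2.trans ?_⟩
  rw [mul_assoc (136 * Real.exp 16)]
  refine mul_le_mul_of_nonneg_left ?_ (by positivity)
  refine (cB_sum Cd hCd0 hCd (3 ^ k) T hT).trans ?_
  rw [mul_assoc Cd]
  refine mul_le_mul_of_nonneg_left ?_ hCd0
  have s1 := S_one k
  have s2 := S_two k
  have s1' : ∑ n ∈ Finset.Ico 1 (3 ^ k), cantorR n ^ 2 * (n : ℝ) ^ (1/200 - 1 : ℝ) ≤ 375 := by
    refine s1.trans ?_
    have : (0:ℝ) ≤ (9/10) ^ k := by positivity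
    linarith
  have n1 : 0 ≤ ∑ n ∈ Finset.Ico 1 (3 ^ k), cantorR n ^ 2 * (n : ℝ) ^ (1/200 - 1 : ℝ) :=
    Finset.sum_nonneg fun i _ => by positivity
  have n2 : 0 ≤ ∑ n ∈ Finset.Ico 1 (3 ^ k), cantorR n ^ 2 * (n : ℝ) ^ (1/200 : ℝ) :=
    Finset.sum_nonneg fun i _ => by positivity
  have e2 : (((3 ^ k : ℕ) : ℝ) ^ (3/8 : ℝ)) ^ 2 = ((3 ^ k : ℕ) : ℝ) ^ (3/4 : ℝ) := by
    rw [← Real.rpow_natCast, ← Real.rpow_mul (by positivity)]; norm_num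
  calc _ ≤ T * 375 ^ 2 + (25 * ((3 ^ k : ℕ) : ℝ) ^ (3/8 : ℝ)) ^ 2 := by gcongr
    _ = 375 ^ 2 * T + 625 * ((3 ^ k : ℕ) : ℝ) ^ (3/4 : ℝ) := by rw [mul_pow, e2]; ring
    _ ≤ _ := by
      have : 0 ≤ ((3 ^ k : ℕ) : ℝ) ^ (3/4 : ℝ) := by positivity
      linarith
/-- Gaussian fourth-moment upper bound for the Cantor Dirichlet series:
`∫_T^{2T} |L(1/2+it)|⁴ dt ≪ T (log T)³`. -/
theorem cantor_fourth_moment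
    (L : ℂ → ℂ) (hL : Differentiable ℂ L)
    (hLeq : ∀ s : ℂ, 1 < s.re → L s = cantorSeries s) :
    ∃ K : ℝ, ∀ T : ℝ, 3 ≤ T →
      (∫ t in T..(2 * T), ‖L (1 / 2 + t * Complex.I)‖ ^ 4) ≤
        K * T * (Real.log T) ^ 3 := by
  obtain ⟨C, hC0, hC⟩ := fourth_gauss
  refine ⟨8 * Real.exp 4 * (C * 4) + 8 * 6420 ^ 4, fun T hT => ?_⟩
  have hT0 : 0 < T := by linarith
  have hT1 : 1 ≤ T := by linarith
  have hX1 : 1 ≤ T ^ (4/3 : ℝ) := Real.one_le_rpow hT1 (by norm_num)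
  obtain ⟨n, hn1, hn2⟩ := exists_nat_pow_near hX1 (by norm_num : (1:ℝ) < 3)
  obtain ⟨M, hM⟩ : ∃ M : ℕ, M + 1 = 3 ^ (n + 1) :=
    ⟨3 ^ (n+1) - 1, Nat.sub_add_cancel (Nat.one_le_pow _ _ (by norm_num))⟩
  have hMr : ((M + 1 : ℕ) : ℝ) = 3 ^ (n + 1) := by rw [hM]; push_cast; rfl
  have hMT : T ^ (4/3 : ℝ) ≤ ((M + 1 : ℕ) : ℝ) := by rw [hMr]; exact hn2.le
  obtain ⟨hInt, hbd⟩ := hC T hT1 (n+1) M hM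
  have hN : ((3 ^ (n+1) : ℕ) : ℝ) ^ (3/4 : ℝ) ≤ 3 * T := by
    have h1 : ((3 ^ (n+1) : ℕ) : ℝ) ≤ 3 * T ^ (4/3 : ℝ) := by push_cast; rw [pow_succ]; linarith
    calc _ ≤ (3 * T ^ (4/3 : ℝ)) ^ (3/4 : ℝ) := by gcongr
      _ = 3 ^ (3/4 : ℝ) * T := by
        rw [Real.mul_rpow (by norm_num) (by positivity), ← Real.rpow_mul hT0.le]; norm_num
      _ ≤ 3 ^ (1 : ℝ) * T := by
        gcongr
        · norm_num
        · norm_num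
      _ = 3 * T := by rw [Real.rpow_one]
  have hpt : ∀ t ∈ Set.Icc T (2 * T), ‖L (1 / 2 + t * Complex.I)‖ ^ 4 ≤
      8 * Real.exp 4 * (Real.exp (-(1 / T ^ 2) * t ^ 2) * ‖cP M (1/2 + t * Complex.I)‖ ^ 4) + 8 * 6420 ^ 4 := by
    intro t ht
    have ht0 : 0 ≤ t := hT0.le.trans ht.1
    set s : ℂ := 1 / 2 + t * Complex.I with hs
    have hsre : s.re = 1/2 := by simp [hs]
    have hsn : ‖s‖ ≤ 1/2 + 2 * T := by
      calc ‖s‖ ≤ ‖(1/2 : ℂ)‖ + ‖(t : ℂ) * Complex.I‖ := norm_add_le _ _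
        _ = 1/2 + t := by simp [abs_of_nonneg ht0]
        _ ≤ _ := by linarith [ht.2]
    have happ := L_approx L hL hLeq s (by rw [hsre]; norm_num) M
    have hB : cBnd s.re ‖s‖ M ≤ 6420 := by
      unfold cBnd
      rw [hsre]
      have hM1 : (1:ℝ) ≤ ((M + 1 : ℕ) : ℝ) := by exact_mod_cast (by omega)
      have a1 : ((M + 1 : ℕ) : ℝ) ^ (-(1/2) : ℝ) ≤ 1 := Real.rpow_le_one_of_one_le_of_nonpos hM1 (by norm_num)
      have a2 : ((M + 1 : ℕ) : ℝ) ^ (-(1/2 + 1) : ℝ) ≤ 1 / T ^ 2 := by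
        calc _ ≤ (T ^ (4/3 : ℝ)) ^ (-(1/2 + 1) : ℝ) :=
              Real.rpow_le_rpow_of_nonpos (by positivity) hMT (by norm_num)
          _ = T ^ (-2 : ℝ) := by rw [← Real.rpow_mul hT0.le]; norm_num
          _ = 1 / T ^ 2 := by rw [Real.rpow_neg hT0.le]; simp
      have a3 : (‖s‖ + 1) ^ 2 ≤ (4 * T) ^ 2 := by gcongr; linarith
      calc _ ≤ 20 * 1 + 400 * (4 * T) ^ 2 * (1 / T ^ 2) := by gcongr
        _ = 6420 := by field_simp; norm_num
    have hLn : ‖L s‖ ≤ ‖cP M s‖ + 6420 := by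
      have := norm_add_le (L s - cP M s) (cP M s)
      rw [sub_add_cancel] at this
      linarith
    have hw : 1 ≤ Real.exp 4 * Real.exp (-(1 / T ^ 2) * t ^ 2) := by
      rw [← Real.exp_add]
      apply Real.one_le_exp
      have : (1 / T ^ 2) * t ^ 2 ≤ (1 / T ^ 2) * (2 * T) ^ 2 := by gcongr; exact ht.2
      have e : (1 / T ^ 2) * (2 * T) ^ 2 = 4 := by field_simp; norm_num
      linarith
    calc ‖L s‖ ^ 4 ≤ (‖cP M s‖ + 6420) ^ 4 := by gcongr
      _ ≤ 2 ^ (4 - 1) * (‖cP M s‖ ^ 4 + 6420 ^ 4) := add_pow_le (norm_nonneg _) (by norm_num) 4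
      _ = 8 * (1 * ‖cP M s‖ ^ 4) + 8 * 6420 ^ 4 := by norm_num; ring
      _ ≤ 8 * ((Real.exp 4 * Real.exp (-(1 / T ^ 2) * t ^ 2)) * ‖cP M s‖ ^ 4) + 8 * 6420 ^ 4 := by gcongr
      _ = _ := by ring
  have hcont : Continuous (fun t : ℝ => ‖L (1 / 2 + t * Complex.I)‖ ^ 4) := by
    have := hL.continuous
    fun_prop
  have hTT : T ≤ 2 * T := by linarith
  have hI := (hInt.const_mul (8 * Real.exp 4)).intervalIntegrable (a := T) (b := 2 * T)
  have hmono := intervalIntegral.integral_mono_on hTT (hcont.intervalIntegrable T (2 * T))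
    (hI.add (intervalIntegrable_const (c := (8 * 6420 ^ 4 : ℝ)))) hpt
  rw [intervalIntegral.integral_add hI intervalIntegrable_const, intervalIntegral.integral_const_mul,
    intervalIntegral.integral_const, intervalIntegral.integral_of_le hTT, intervalIntegral.integral_of_le hTT] at hmono
  rw [intervalIntegral.integral_of_le hTT]
  have hset := MeasureTheory.setIntegral_le_integral (s := Set.Ioc T (2 * T)) hInt
    (Filter.Eventually.of_forall fun t => by positivity)
  have hb2 : ∫ t : ℝ, Real.exp (-(1 / T ^ 2) * t ^ 2) * ‖cP M (1/2 + t * Complex.I)‖ ^ 4 ≤ C * 4 * T := by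
    refine hbd.trans ?_
    rw [mul_assoc]
    gcongr
    linarith
  have hlog : 1 ≤ Real.log T := by
    rw [Real.le_log_iff_exp_le hT0]
    linarith [Real.exp_one_lt_d9]
  have hlog3 : 1 ≤ Real.log T ^ 3 := one_le_pow₀ hlog
  calc _ ≤ _ := hmono
    _ ≤ 8 * Real.exp 4 * (C * 4 * T) + (2 * T - T) • (8 * 6420 ^ 4 : ℝ) := by
      gcongr
      exact hset.trans hb2
    _ = (8 * Real.exp 4 * (C * 4) + 8 * 6420 ^ 4) * T * 1 := by rw [smul_eq_mul]; ring
    _ ≤ _ := by gcongr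
end
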